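/- arXiv:1912.06345 — 7 statements merged into one kernel-verified Lean document; each statement's English description precedes it below -/
import Mathlib

section
/- For every integer n ≥ 1, the polynomial P_n satisfies P_n(x) = Σ_{k=1}^{4n−1} c_k·(x+5)^{k−1}, where c_k = A_{−k}(n) − Σ_{j=0}^{3n} binom(j+k−1, j)·A_j(n)/10^{j+k}. -/
/-- The rational function `R_n(x) = 5 x^{2n} (x⁴+6x²+25)^{2n} / ((5+x)^{3n+1} (5-x)^{3n+1})`. -/
noncomputable def R (n : ℕ) : ℂ → ℂ := fun x =>
  5 * x ^ (2 * n) * (x ^ 4 + 6 * x ^ 2 + 25) ^ (2 * n) /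
    ((5 + x) ^ (3 * n + 1) * (5 - x) ^ (3 * n + 1))

/-- `A j n`: the Laurent coefficient of `(x+5)^{-(j+1)}` of `R_n` at `x = -5`, i.e.
`(1/(3n-j)!) (d/dx)^{3n-j} [(x+5)^{3n+1} R_n(x)]` at `x = -5`, where
`(x+5)^{3n+1} R_n(x) = 5 x^{2n} (x⁴+6x²+25)^{2n} / (5-x)^{3n+1}`. -/
noncomputable def A (n : ℕ) (j : ℤ) : ℂ :=
  (1 / ((3 * (n : ℤ) - j).toNat.factorial : ℂ)) *
    iteratedDeriv (3 * (n : ℤ) - j).toNat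
      (fun x : ℂ =>
        5 * x ^ (2 * n) * (x ^ 4 + 6 * x ^ 2 + 25) ^ (2 * n) / (5 - x) ^ (3 * n + 1))
      (-5)

/-- The formal Taylor series of `f` at `a`. -/
noncomputable def taylorPowerSeries (f : ℂ → ℂ) (a : ℂ) : PowerSeries ℂ :=
  PowerSeries.mk fun m => iteratedDeriv m f a / m.factorial

theorem taylorPowerSeries_mul {f g : ℂ → ℂ} {a : ℂ} (hf : ∀ m : ℕ, ContDiffAt ℂ m f a)
    (hg : ∀ m : ℕ, ContDiffAt ℂ m g a) :
    taylorPowerSeries (f * g) a = taylorPowerSeries f a * taylorPowerSeries g a := by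
  ext m
  rw [PowerSeries.coeff_mul, Finset.Nat.sum_antidiagonal_eq_sum_range_succ_mk]
  simp only [taylorPowerSeries, PowerSeries.coeff_mk]
  rw [iteratedDeriv_mul (hf m) (hg m), Finset.sum_div]
  refine Finset.sum_congr rfl fun i hi => ?_
  rw [Nat.cast_choose ℂ (Finset.mem_range_succ_iff.mp hi)]
  have := Nat.cast_ne_zero (R := ℂ).mpr m.factorial_ne_zero
  field_simp

theorem taylorPowerSeries_congr {f g : ℂ → ℂ} {a : ℂ} (h : f =ᶠ[nhds a] g) :
    taylorPowerSeries f a = taylorPowerSeries g a := by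
  ext m
  simp only [taylorPowerSeries, PowerSeries.coeff_mk, h.iteratedDeriv_eq]

theorem taylorPowerSeries_polynomial (p : Polynomial ℂ) (a : ℂ) :
    taylorPowerSeries (fun x => p.eval x) a = (Polynomial.taylor a p : PowerSeries ℂ) := by
  have key (m : ℕ) : ∀ q : Polynomial ℂ, iteratedDeriv m (fun x => q.eval x) =
      fun x => (Polynomial.derivative^[m] q).eval x := by
    induction m with
    | zero => simp
    | succ m ih =>
      intro q
      rw [iteratedDeriv_succ', Function.iterate_succ_apply, ← ih]
      congr 1
      funext x
      exact q.deriv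
  ext m
  have h := congrArg (fun q => q.eval a)
    (congrFun (Polynomial.factorial_smul_hasseDeriv (R := ℂ) m) p)
  change (m.factorial • Polynomial.hasseDeriv m p).eval a = _ at h
  rw [Polynomial.eval_smul, nsmul_eq_mul] at h
  rw [taylorPowerSeries, PowerSeries.coeff_mk, Polynomial.coeff_coe, Polynomial.taylor_coeff,
    key]
  beta_reduce
  rw [← h, mul_div_cancel_left₀ _ (Nat.cast_ne_zero.mpr m.factorial_ne_zero)]

section PartialFractions

open Polynomial

variable {K : Type*} [Field K]

theorem PowerSeries.C_sub_X_pow_mul_mk {c : K} (hc : c ≠ 0) (j : ℕ) :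
    (PowerSeries.C c - PowerSeries.X) ^ (j + 1) *
      PowerSeries.mk (fun i => ((j + i).choose j : K) / c ^ (j + i + 1)) = 1 := by
  have h := congrArg (PowerSeries.rescale c⁻¹)
    (PowerSeries.mk_add_choose_mul_one_sub_pow_eq_one K j)
  have hX : PowerSeries.C c - PowerSeries.X =
      PowerSeries.C c * PowerSeries.rescale c⁻¹ (1 - PowerSeries.X) := by
    rw [map_sub, map_one, PowerSeries.rescale_X, mul_sub, mul_one, ← mul_assoc, ← map_mul,
      mul_inv_cancel₀ hc, map_one, one_mul]
  have hU : PowerSeries.mk (fun i => ((j + i).choose j : K) / c ^ (j + i + 1)) =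
      PowerSeries.C (c⁻¹ ^ (j + 1)) *
        PowerSeries.rescale c⁻¹ (PowerSeries.mk fun i => ((j + i).choose j : K)) := by
    ext i
    simp only [PowerSeries.coeff_mk, PowerSeries.coeff_C_mul, PowerSeries.coeff_rescale]
    rw [← mul_assoc, ← pow_add, inv_pow, div_eq_inv_mul, add_right_comm j i 1]
  rw [map_mul, map_pow, map_one] at h
  rw [hX, hU, mul_pow, mul_mul_mul_comm, mul_comm (PowerSeries.rescale _ _ ^ _), h, ← map_pow,
    ← map_mul, ← mul_pow, mul_inv_cancel₀ hc, one_pow, map_one, one_mul]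

/-- Partial fractions of `N / (X (c - X)) ^ (m + 1)` when `N` is invariant under `X ↦ c - X`:
the polynomial part, together with its coefficients in terms of the expansion `T` of
`N / (c - X) ^ (m + 1)` at the origin. -/
theorem exists_polynomial_part_of_symmetric {c : K} (hc : c ≠ 0) (m d : ℕ) (N : K[X])
    (hN : N.comp (C c - X) = N) (hd : N.natDegree ≤ 2 * (m + 1) + d) (T : PowerSeries K)
    (hT : (PowerSeries.C c - PowerSeries.X) ^ (m + 1) * T = (N : PowerSeries K)) :
    ∃ Q : K[X], Q.natDegree ≤ d ∧
      N = (C c - X) ^ (m + 1) * T.trunc (m + 1) +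
        X ^ (m + 1) * (T.trunc (m + 1)).comp (C c - X) + X ^ (m + 1) * (C c - X) ^ (m + 1) * Q ∧
      ∀ i, Q.coeff i = PowerSeries.coeff (m + 1 + i) T -
        ∑ j ∈ Finset.range (m + 1),
          ((j + i).choose j : K) * PowerSeries.coeff (m - j) T / c ^ (j + i + 1) := by
  set S := T.trunc (m + 1) with hS
  set L : K[X] := C c - X with hL
  have hLc : ((L : K[X]) : PowerSeries K) = PowerSeries.C c - PowerSeries.X := by
    simp [hL]
  have hLL : L.comp L = X := by simp [hL]
  have hLdeg : L.natDegree = 1 := by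
    rw [hL, natDegree_sub_eq_right_of_natDegree_lt] <;> simp
  have hL0 : L ≠ 0 := fun h => by simp [h] at hLdeg
  have hcop : IsCoprime ((X : K[X]) ^ (m + 1)) (L ^ (m + 1)) := by
    refine IsCoprime.pow ⟨C c⁻¹, C c⁻¹, ?_⟩
    rw [hL, ← mul_add, add_sub_cancel, ← C_mul, inv_mul_cancel₀ hc, C_1]
  obtain ⟨T', hT'⟩ : ∃ T' : PowerSeries K, T = PowerSeries.X ^ (m + 1) * T' + (S : PowerSeries K) :=
    ⟨_, PowerSeries.eq_X_pow_mul_shift_add_trunc (m + 1) T⟩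
  have hNS : ((N - L ^ (m + 1) * S : K[X]) : PowerSeries K) =
      PowerSeries.X ^ (m + 1) * (T' * (PowerSeries.C c - PowerSeries.X) ^ (m + 1)) := by
    rw [coe_sub, coe_mul, coe_pow, hLc, ← hT]
    nth_rewrite 1 [hT']
    ring
  have hdvd : X ^ (m + 1) ∣ N - L ^ (m + 1) * S := by
    rw [X_pow_dvd_iff]
    intro i hi
    rw [← coeff_coe, hNS, PowerSeries.coeff_X_pow_mul', if_neg (not_le.mpr hi)]
  have hdvd' : L ^ (m + 1) ∣ N - X ^ (m + 1) * S.comp L := by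
    obtain ⟨q, hq⟩ := hdvd
    refine ⟨q.comp L, ?_⟩
    have := congrArg (fun p => p.comp L) hq
    simpa [sub_comp, mul_comp, hN, hLL] using this
  obtain ⟨Q, hQ⟩ : X ^ (m + 1) * L ^ (m + 1) ∣
      N - L ^ (m + 1) * S - X ^ (m + 1) * S.comp L := by
    refine hcop.mul_dvd (dvd_sub hdvd (dvd_mul_right _ _)) ?_
    rw [sub_right_comm]
    exact dvd_sub hdvd' (dvd_mul_right _ _)
  have hNQ : N = L ^ (m + 1) * S + X ^ (m + 1) * S.comp L + X ^ (m + 1) * L ^ (m + 1) * Q := by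
    rw [← hQ]; ring
  have hSdeg : S.natDegree < m + 1 := PowerSeries.natDegree_trunc_lt T m
  refine ⟨Q, ?_, hNQ, ?_⟩
  · rcases eq_or_ne Q 0 with rfl | hQ0
    · simp
    have hX0 : (X : K[X]) ^ (m + 1) ≠ 0 := pow_ne_zero _ X_ne_zero
    have hdeg := congrArg natDegree hQ
    rw [natDegree_mul (mul_ne_zero hX0 (pow_ne_zero _ hL0)) hQ0,
      natDegree_mul hX0 (pow_ne_zero _ hL0), natDegree_pow, natDegree_pow, hLdeg,
      natDegree_X] at hdeg
    have h1 : (L ^ (m + 1) * S).natDegree ≤ 2 * (m + 1) + d := by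
      refine natDegree_mul_le.trans ?_
      rw [natDegree_pow, hLdeg]
      omega
    have h2 : (X ^ (m + 1) * S.comp L).natDegree ≤ 2 * (m + 1) + d := by
      refine natDegree_mul_le.trans ?_
      rw [natDegree_pow, natDegree_comp, hLdeg, natDegree_X]
      omega
    have := natDegree_sub_le_of_le (natDegree_sub_le_of_le hd h1) h2
    simp only [max_self] at this
    omega
  · have hSL : (S.comp L : PowerSeries K) = (PowerSeries.C c - PowerSeries.X) ^ (m + 1) *
        ∑ j ∈ Finset.range (m + 1), PowerSeries.C (PowerSeries.coeff (m - j) T) *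
          PowerSeries.mk (fun i => ((j + i).choose j : K) / c ^ (j + i + 1)) := by
      rw [comp_eq_sum_left, sum_over_range' _ (by simp) _ hSdeg, ← Finset.sum_range_reflect,
        Finset.mul_sum, ← coeToPowerSeries.ringHom_apply, map_sum]
      refine Finset.sum_congr rfl fun j hj => ?_
      have hj' := Finset.mem_range_succ_iff.mp hj
      rw [coeToPowerSeries.ringHom_apply, coe_mul, coe_pow, hLc, coe_C,
        show m + 1 - 1 - j = m - j by omega, hS, PowerSeries.coeff_trunc,
        if_pos (by omega : m - j < m + 1), mul_left_comm]
      congr 1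
      rw [show m + 1 = (m - j) + (j + 1) by omega, pow_add, mul_assoc,
        PowerSeries.C_sub_X_pow_mul_mk hc, mul_one]
    have hT'Q : T' = (Q : PowerSeries K) +
        ∑ j ∈ Finset.range (m + 1), PowerSeries.C (PowerSeries.coeff (m - j) T) *
          PowerSeries.mk (fun i => ((j + i).choose j : K) / c ^ (j + i + 1)) := by
      have hL0' : (PowerSeries.C c - PowerSeries.X : PowerSeries K) ^ (m + 1) ≠ 0 := by
        rw [← hLc, ← coe_pow]
        exact fun h => pow_ne_zero (m + 1) hL0 (coe_eq_zero_iff.mp h)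
      refine mul_left_cancel₀ hL0' (PowerSeries.X_pow_mul_cancel (k := m + 1) ?_)
      rw [mul_comm _ T', ← hNS, mul_add, ← hSL]
      have : N - L ^ (m + 1) * S = X ^ (m + 1) * (L ^ (m + 1) * Q + S.comp L) := by
        rw [← sub_eq_zero, ← sub_eq_zero.mpr hNQ]; ring
      rw [this, coe_mul, coe_add, coe_mul, coe_pow, coe_pow, hLc, coe_X]
    intro i
    have h1 : PowerSeries.coeff (m + 1 + i) T = PowerSeries.coeff i T' := by
      rw [hT', map_add, add_comm (m + 1) i, PowerSeries.coeff_X_pow_mul, coeff_coe,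
        coeff_eq_zero_of_natDegree_lt (by omega), add_zero]
    rw [h1, hT'Q, map_add, coeff_coe, map_sum, eq_sub_iff_add_eq]
    congr 1
    refine Finset.sum_congr rfl fun j _ => ?_
    rw [PowerSeries.coeff_C_mul, PowerSeries.coeff_mk]
    ring

end PartialFractions

/-- The polynomial part `P_n(x) = R_n(x) - Σ_{j=0}^{3n}(A_j/(5+x)^{j+1} + A_j/(5-x)^{j+1})`
of the partial-fraction decomposition of `R_n` equals
`Σ_{k=1}^{4n-1} (A_{-k} - Σ_{j=0}^{3n} binom(j+k-1, j) A_j / 10^{j+k}) (x+5)^{k-1}`. -/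
theorem Ppart_expansion_at_minus_five (n : ℕ) (hn : 1 ≤ n) (x : ℂ) (hx : x ≠ 5)
    (hx' : x ≠ -5) :
    R n x - ∑ j ∈ Finset.range (3 * n + 1),
        (A n (j : ℤ) / (5 + x) ^ (j + 1) + A n (j : ℤ) / (5 - x) ^ (j + 1)) =
      ∑ k ∈ Finset.Icc 1 (4 * n - 1),
        (A n (-(k : ℤ)) -
            ∑ j ∈ Finset.range (3 * n + 1),
              ((j + k - 1).choose j : ℂ) * A n (j : ℤ) / 10 ^ (j + k)) *
          (x + 5) ^ (k - 1) := by
  set G : ℂ → ℂ := fun x =>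
    5 * x ^ (2 * n) * (x ^ 4 + 6 * x ^ 2 + 25) ^ (2 * n) / (5 - x) ^ (3 * n + 1) with hG
  set T := taylorPowerSeries G (-5) with hT
  have hA (j : ℤ) : A n j = PowerSeries.coeff (3 * (n : ℤ) - j).toNat T := by
    rw [hT, taylorPowerSeries, PowerSeries.coeff_mk, A, one_div_mul_eq_div]
  set p : Polynomial ℂ := 5 * Polynomial.X ^ (2 * n) *
    (Polynomial.X ^ 4 + 6 * Polynomial.X ^ 2 + 25) ^ (2 * n) with hp
  have hp_eval (y : ℂ) : p.eval y = 5 * y ^ (2 * n) * (y ^ 4 + 6 * y ^ 2 + 25) ^ (2 * n) := by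
    simp [hp]
  have hp_neg : p.comp (-Polynomial.X) = p := by
    simp [hp, pow_mul, (by decide : Even 4).neg_pow]
  have hp_deg : p.natDegree ≤ 2 * (3 * n + 1) + (4 * n - 2) := by
    have : p.natDegree ≤ 0 + (2 * n) * 1 + (2 * n) * 4 := by
      rw [hp]
      compute_degree
      omega
    omega
  have hTN : (PowerSeries.C 10 - PowerSeries.X) ^ (3 * n + 1) * T =
      (Polynomial.taylor (-5) p : PowerSeries ℂ) := by
    have hD := taylorPowerSeries_polynomial ((Polynomial.C 5 - Polynomial.X) ^ (3 * n + 1)) (-5)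
    have h5 : (5 - (-5) : ℂ) ^ (3 * n + 1) ≠ 0 := pow_ne_zero _ (by norm_num)
    have hcoe : ((Polynomial.taylor (-5) ((Polynomial.C (5 : ℂ) - Polynomial.X) ^ (3 * n + 1)) :
        Polynomial ℂ) : PowerSeries ℂ) =
        (PowerSeries.C 10 - PowerSeries.X) ^ (3 * n + 1) := by
      have : Polynomial.taylor (-5 : ℂ) ((Polynomial.C (5 : ℂ) - Polynomial.X) ^ (3 * n + 1)) =
          (Polynomial.C 10 - Polynomial.X) ^ (3 * n + 1) := by
        rw [Polynomial.taylor_pow, map_sub, Polynomial.taylor_C, Polynomial.taylor_X]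
        congr 1
        rw [show (10 : ℂ) = 5 + 5 by norm_num, map_add, map_neg]
        ring
      rw [this]
      simp
    rw [← hcoe, ← hD, ← taylorPowerSeries_polynomial, hT, ← taylorPowerSeries_mul]
    · refine taylorPowerSeries_congr ?_
      have hne : ∀ᶠ y : ℂ in nhds (-5), (5 - y) ^ (3 * n + 1) ≠ 0 :=
        ContinuousAt.eventually_ne (by fun_prop) h5
      filter_upwards [hne] with y hy
      rw [hp_eval, Pi.mul_apply, hG]
      simp only [Polynomial.eval_pow, Polynomial.eval_sub, Polynomial.eval_C, Polynomial.eval_X]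
      rw [mul_div_cancel₀ _ hy]
    · intro m
      simp only [Polynomial.eval_pow, Polynomial.eval_sub, Polynomial.eval_C, Polynomial.eval_X]
      fun_prop
    · intro m
      exact ContDiffAt.div (by fun_prop) (by fun_prop) h5
  have hsymm : (Polynomial.taylor (-5) p).comp (Polynomial.C 10 - Polynomial.X) =
      Polynomial.taylor (-5) p := by
    rw [Polynomial.taylor_apply, Polynomial.comp_assoc]
    nth_rewrite 1 [← hp_neg]
    rw [Polynomial.comp_assoc]
    congr 1
    simp only [Polynomial.neg_comp, Polynomial.add_comp, Polynomial.X_comp, Polynomial.C_comp]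
    rw [show (10 : ℂ) = 5 + 5 by norm_num, map_add, map_neg]
    ring
  obtain ⟨Q, hQdeg, hQ, hQcoeff⟩ := exists_polynomial_part_of_symmetric (c := (10 : ℂ))
    (by norm_num) (3 * n) (4 * n - 2) (Polynomial.taylor (-5) p) hsymm
    (by rwa [Polynomial.natDegree_taylor]) T hTN
  have hAj (j : ℕ) : A n (j : ℤ) = PowerSeries.coeff (3 * n - j) T := by
    rw [hA]; congr 2; omega
  have hAk (i : ℕ) : A n (-((i + 1 : ℕ) : ℤ)) = PowerSeries.coeff (3 * n + 1 + i) T := by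
    rw [hA]; congr 2; omega
  have hplus : x + 5 ≠ 0 := fun h => hx' (eq_neg_of_add_eq_zero_left h)
  have hminus : 5 - x ≠ 0 := sub_ne_zero.mpr hx.symm
  have hS (t : ℂ) (ht : t ≠ 0) : (T.trunc (3 * n + 1)).eval t / t ^ (3 * n + 1) =
      ∑ j ∈ Finset.range (3 * n + 1), A n (j : ℤ) / t ^ (j + 1) := by
    rw [Polynomial.eval_eq_sum_range' (PowerSeries.natDegree_trunc_lt T (3 * n)),
      ← Finset.sum_range_reflect, Finset.sum_div]
    refine Finset.sum_congr rfl fun j hj => ?_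
    have hj' := Finset.mem_range_succ_iff.mp hj
    rw [show 3 * n + 1 - 1 - j = 3 * n - j by omega, PowerSeries.coeff_trunc,
      if_pos (by omega : 3 * n - j < 3 * n + 1), hAj,
      show t ^ (3 * n + 1) = t ^ (3 * n - j) * t ^ (j + 1) by rw [← pow_add]; congr 1; omega]
    field_simp
  have hR : R n x = (T.trunc (3 * n + 1)).eval (x + 5) / (x + 5) ^ (3 * n + 1) +
      (T.trunc (3 * n + 1)).eval (5 - x) / (5 - x) ^ (3 * n + 1) + Q.eval (x + 5) := by
    have h := congrArg (fun q => q.eval (x + 5)) hQ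
    simp only [Polynomial.taylor_eval, Polynomial.eval_add, Polynomial.eval_mul,
      Polynomial.eval_pow, Polynomial.eval_sub, Polynomial.eval_C, Polynomial.eval_X,
      Polynomial.eval_comp, show (10 : ℂ) - (x + 5) = 5 - x by ring] at h
    rw [show x + 5 + -5 = x by ring, hp_eval] at h
    rw [R, h, add_comm 5 x]
    field_simp
  rw [hR, hS _ hplus, hS _ hminus, Finset.sum_add_distrib, add_comm 5 x, add_sub_cancel_left,
    Polynomial.eval_eq_sum_range' (by omega : Q.natDegree < 4 * n - 1),
    ← Finset.Ico_add_one_right_eq_Icc, Finset.sum_Ico_eq_sum_range]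
  refine Finset.sum_congr (by simp) fun i _ => ?_
  rw [add_comm 1 i, hAk, hQcoeff, Nat.add_sub_cancel]
  simp only [hAj, ← add_assoc, Nat.add_sub_cancel]
end

section
/- Let n ≥ 1 be an integer, let p be a prime in 𝒫_n, and let j be an integer with −4n+1 ≤ j ≤ 3n and p | j. Then for all integers n₁, n₂ ≥ 0, p divides binom(2n, n₁)·binom(2n, n₂)·Z(n, n₁+n₂, j). -/
/-- `inP n p` : `p` belongs to the set `𝒫_n` of primes `p > max(5, √(3n))` with
`1/2 ≤ {n/p} < 2/3`. -/
def inP (n p : ℕ) : Prop :=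
  p.Prime ∧ max 5 (Real.sqrt (3 * n)) < (p : ℝ) ∧
    1 / 2 ≤ Int.fract ((n : ℝ) / p) ∧ Int.fract ((n : ℝ) / p) < 2 / 3

/-- Binomial coefficient `binom(a, b)` for integers `a, b`, with the convention that it
vanishes when `a < b` or `b < 0`. -/
def zchoose (a b : ℤ) : ℤ := if 0 ≤ a ∧ 0 ≤ b then (a.toNat.choose b.toNat : ℤ) else 0

/-- `Z(n,m,j) = Σ_{n₀ ≥ 0} (-2)^{n₀} binom(2n+2m, n₀) binom(6n-j-n₀, 3n)`. -/
def Z (n m : ℕ) (j : ℤ) : ℤ :=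
  ∑ n₀ ∈ Finset.range (2 * n + 2 * m + 1),
    (-2) ^ n₀ * ((2 * n + 2 * m).choose n₀ : ℤ) * zchoose (6 * (n : ℤ) - j - n₀) (3 * n)

section FiniteFieldSums

variable {p : ℕ} [Fact p.Prime]

lemma ZMod.sum_pow_of_lt {i : ℕ} (hi : i < 2 * (p - 1)) :
    ∑ x : ZMod p, x ^ i = if i = p - 1 then -1 else 0 := by
  have hp := (Fact.out : p.Prime).two_le
  have hcard : Fintype.card (ZMod p) - 1 = p - 1 := by rw [ZMod.card]
  rcases lt_trichotomy i (p - 1) with h | rfl | h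
  · rw [if_neg h.ne]
    exact FiniteField.sum_pow_lt_card_sub_one _ i (hcard ▸ h)
  · have hx (x : ZMod p) : x ^ (p - 1) = 1 - if x = 0 then 1 else 0 := by
      split_ifs with h
      · rw [h, zero_pow (by omega), sub_self]
      · rw [ZMod.pow_card_sub_one_eq_one h, sub_zero]
    simp [hx]
  · rw [if_neg h.ne']
    have hx (x : ZMod p) : x ^ i = x ^ (i - (p - 1)) := by
      rw [show i = p + (i - p) by omega, pow_add, ZMod.pow_card, ← pow_succ']
      congr 1
      omega
    simp_rw [hx]
    exact FiniteField.sum_pow_lt_card_sub_one _ _ (by omega)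

open Polynomial in
lemma ZMod.sum_eval_eq_neg_coeff {f : (ZMod p)[X]} (hf : f.natDegree < 2 * (p - 1)) :
    ∑ x : ZMod p, f.eval x = -f.coeff (p - 1) := by
  have hp := (Fact.out : p.Prime).two_le
  simp_rw [eval_eq_sum_range' hf]
  rw [Finset.sum_comm]
  simp_rw [← Finset.mul_sum]
  rw [Finset.sum_congr rfl fun i hi =>
    congrArg (f.coeff i * ·) (ZMod.sum_pow_of_lt (Finset.mem_range.mp hi))]
  simp only [mul_ite, mul_neg, mul_one, mul_zero, Finset.sum_ite_eq', Finset.mem_range]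
  rw [if_pos (by omega)]

open Polynomial in
/-- The polynomial `(X (1 - X))^e (1 - 2X)^m` is odd about `1/2` when `m` is odd, so its values
over `ZMod p` sum to zero. -/
lemma ZMod.coeff_one_sub_two_mul_X_pow_mul_one_sub_X_pow (hp : p ≠ 2) {m t e : ℕ}
    (hm : Odd m) (hte : t + e = p - 1) (hdeg : 2 * e + m < 2 * (p - 1)) :
    ((1 - 2 * X) ^ m * (1 - X) ^ e : (ZMod p)[X]).coeff t = 0 := by
  set g : (ZMod p)[X] := X ^ e * ((1 - 2 * X) ^ m * (1 - X) ^ e) with hg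
  have hgdeg : g.natDegree < 2 * (p - 1) := by
    have : g.natDegree ≤ e + (m + e) := by rw [hg]; compute_degree
    omega
  have hsum := ZMod.sum_eval_eq_neg_coeff hgdeg
  have hodd : ∑ x : ZMod p, g.eval x = -∑ x : ZMod p, g.eval x := by
    rw [← Finset.sum_neg_distrib, ← (Equiv.subLeft (1 : ZMod p)).sum_comp]
    refine Finset.sum_congr rfl fun x _ => ?_
    have hx : (1 - 2 * (1 - x)) ^ m = -(1 - 2 * x) ^ m := by
      rw [← hm.neg_pow]
      ring
    simp only [hg, Equiv.subLeft_apply, eval_mul, eval_pow, eval_sub, eval_one, eval_X, eval_ofNat,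
      hx, sub_sub_cancel]
    ring
  have hzero : ∑ x : ZMod p, g.eval x = 0 := (ZMod.neg_eq_self_iff _).mp hodd.symm |>.elim id
    fun h => by
      have := (Fact.out : p.Prime).eq_one_or_self_of_dvd 2 ⟨_, h.symm⟩
      omega
  rw [hzero, zero_eq_neg, hg, ← hte, coeff_X_pow_mul] at hsum
  exact hsum

end FiniteFieldSums

lemma PowerSeries.coeff_pow_char_eq_zero {R : Type*} [CommRing R] [NoZeroDivisors R]
    (p : ℕ) [CharP R p] (f : PowerSeries R) {i : ℕ} (hi : ¬ p ∣ i) : coeff i (f ^ p) = 0 := by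
  obtain _ | i := i
  · exact absurd (dvd_zero p) hi
  have h : coeff i (derivative R (f ^ p)) = 0 := by
    have hp : (p : PowerSeries R) = 0 := by rw [← map_natCast C, CharP.cast_eq_zero, map_zero]
    rw [derivative_pow, hp, zero_mul, zero_mul, map_zero]
  rw [coeff_derivative] at h
  refine (mul_eq_zero.mp h).resolve_right fun h' => hi ?_
  exact (CharP.cast_eq_zero_iff R p (i + 1)).mp (by exact_mod_cast h')

lemma PowerSeries.coeff_pow_char_mul_eq_zero {R : Type*} [CommRing R] [NoZeroDivisors R]
    (p : ℕ) [CharP R p] (f : PowerSeries R) (g : Polynomial R) {N t : ℕ} (hN : N ≡ t [MOD p])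
    (hg : ∀ k, k ≡ t [MOD p] → g.coeff k = 0) : coeff N (f ^ p * (g : PowerSeries R)) = 0 := by
  rw [coeff_mul]
  refine Finset.sum_eq_zero fun ik hik => ?_
  rw [Finset.HasAntidiagonal.mem_antidiagonal] at hik
  by_cases hi : p ∣ ik.1
  · rw [Polynomial.coeff_coe, hg, mul_zero]
    refine Nat.ModEq.trans ?_ hN
    rw [← hik]
    simpa using ((Nat.modEq_zero_iff_dvd.mpr hi).add_right ik.2).symm
  · rw [coeff_pow_char_eq_zero p f hi, zero_mul]

open PowerSeries in
lemma intCast_Z_eq_coeff {R : Type*} [CommRing R] (n m N : ℕ) :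
    ((Z n m (3 * n - N) : ℤ) : R) =
      coeff N ((1 - 2 * X) ^ (2 * n + 2 * m) * (mk 1 : PowerSeries R) ^ (3 * n + 1)) := by
  rw [mk_one_pow_eq_mk_choose_add, sub_eq_neg_add (1 : PowerSeries R), add_pow,
    Finset.sum_mul, map_sum, Z, Int.cast_sum]
  refine Finset.sum_congr rfl fun k _ => ?_
  have hterm : (-(2 * X : PowerSeries R)) ^ k * 1 ^ (2 * n + 2 * m - k) *
      ((2 * n + 2 * m).choose k : PowerSeries R) =
      C ((-2) ^ k * ((2 * n + 2 * m).choose k : R)) * X ^ k := by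
    simp only [map_mul, map_pow, map_neg, map_ofNat, map_natCast]
    ring
  rw [hterm, mul_assoc (C _), coeff_C_mul, coeff_X_pow_mul', zchoose]
  push_cast
  congr 1
  split_ifs with h₁ h₂ h₂
  · rw [coeff_mk]
    congr 2
    omega
  · rw [Nat.choose_eq_zero_of_lt (by omega)]
    simp
  · omega
  · simp

open PowerSeries in
lemma one_sub_two_mul_X_pow_mul_mk_one_pow {R : Type*} [CommRing R] {p q m b c e : ℕ}
    (h : b + e = p * c) :
    (1 - 2 * X) ^ (p * q + m) * (mk 1 : PowerSeries R) ^ b =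
      ((1 - 2 * X) ^ q * (mk 1) ^ c) ^ p *
        (((1 - 2 * Polynomial.X) ^ m * (1 - Polynomial.X) ^ e : Polynomial R) :
          PowerSeries R) := by
  have hinv : (mk 1 : PowerSeries R) ^ e * (1 - X) ^ e = 1 := by
    rw [← mul_pow, mk_one_mul_one_sub_eq_one, one_pow]
  have htwo : ((2 : Polynomial R) : PowerSeries R) = 2 := by
    exact_mod_cast map_ofNat (Polynomial.coeToPowerSeries.ringHom (R := R)) 2
  simp only [Polynomial.coe_mul, Polynomial.coe_pow, Polynomial.coe_sub, Polynomial.coe_one,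
    Polynomial.coe_X, htwo]
  rw [mul_pow, ← pow_mul, ← pow_mul, mul_comm c p, ← h, pow_add, pow_add, mul_comm q p]
  linear_combination -((1 - 2 * X) ^ (p * q) * (1 - 2 * X) ^ m * (mk 1 : PowerSeries R) ^ b) * hinv

lemma inP.mod_bounds {n p : ℕ} (hp : inP n p) : p ≤ 2 * (n % p) ∧ 3 * (n % p) < 2 * p := by
  obtain ⟨hprime, -, h₁, h₂⟩ := hp
  have hpos : (0 : ℝ) < p := by exact_mod_cast hprime.pos
  rw [Int.fract_div_natCast_eq_div_natCast_mod] at h₁ h₂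
  rw [div_le_div_iff₀ two_pos hpos] at h₁
  rw [div_lt_div_iff₀ hpos three_pos] at h₂
  norm_cast at h₁ h₂
  omega

lemma Nat.Prime.dvd_choose_of_mod_lt_mod {p a b : ℕ} (hp : p.Prime) (h : a % p < b % p) :
    p ∣ a.choose b := by
  have := Fact.mk hp
  have := Choose.choose_modEq_choose_mod_mul_choose_div_nat (n := a) (k := b) (p := p)
  rw [Nat.choose_eq_zero_of_lt h, zero_mul] at this
  exact (Nat.modEq_zero_iff_dvd).mp this

/-- If `p ∈ 𝒫_n` and the last base-`p` digits of `n₁`, `n₂` do not exceed that of `2n`, then `p`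
divides `Z(n, n₁+n₂, j)` for every multiple `j ≤ 3n` of `p`. -/
lemma dvd_Z_of_mod_le_mod {n p n₁ n₂ : ℕ} {j : ℤ} (hp : inP n p) (hj : j ≤ 3 * n)
    (hpj : (p : ℤ) ∣ j) (h₁ : n₁ % p ≤ 2 * n % p) (h₂ : n₂ % p ≤ 2 * n % p) :
    (p : ℤ) ∣ Z n (n₁ + n₂) j := by
  have := Fact.mk hp.1
  have hp5 : 5 < p := by exact_mod_cast (le_max_left _ _).trans_lt hp.2.1
  have hpodd : Odd p := hp.1.odd_of_ne_two (by omega)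
  obtain ⟨hr₁, hr₂⟩ := hp.mod_bounds
  have hn := Nat.div_add_mod n p
  set a := n / p
  set r := n % p
  have hs : 2 * n % p = 2 * r - p := by
    rw [show 2 * n = (2 * r - p) + p * (2 * a + 1) by
      rw [← hn, mul_add, mul_add p]; zify [hr₁]; ring, Nat.add_mul_mod_self_left,
      Nat.mod_eq_of_lt (by omega)]
  rw [hs] at h₁ h₂
  have hd₁ := Nat.div_add_mod n₁ p
  have hd₂ := Nat.div_add_mod n₂ p
  set d₁ := n₁ % p
  set d₂ := n₂ % p
  obtain ⟨N, rfl⟩ : ∃ N : ℕ, j = 3 * n - N := ⟨(3 * n - j).toNat, by omega⟩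
  set t := 3 * r - p with ht
  set e := p - 1 - t with he
  set m := 2 * r - p + 2 * (d₁ + d₂) with hm
  set q := 2 * a + 1 + 2 * (n₁ / p) + 2 * (n₂ / p) with hq
  have hmodd : Odd m := by
    rw [Nat.odd_iff] at hpodd ⊢
    omega
  have hM : 2 * n + 2 * (n₁ + n₂) = p * q + m := by
    rw [← hn, ← hd₁, ← hd₂, hm, hq]
    zify [hr₁]
    ring
  have hb : 3 * n + 1 + e = p * (3 * a + 2) := by
    have : 3 * r + 1 + e = 2 * p := by omega
    rw [← hn]
    linear_combination this
  have hNt : N ≡ t [MOD p] := by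
    rw [← Int.natCast_modEq_iff]
    refine Int.modEq_iff_dvd.mpr ?_
    have : (t : ℤ) - N = (3 * n - N) - p * (3 * a + 1) := by
      have : (t : ℤ) = 3 * r - p := by omega
      rw [this, ← hn]
      push_cast
      ring
    rw [this]
    exact dvd_sub hpj (dvd_mul_right _ _)
  rw [← ZMod.intCast_zmod_eq_zero_iff_dvd, intCast_Z_eq_coeff, hM,
    one_sub_two_mul_X_pow_mul_mk_one_pow hb]
  refine PowerSeries.coeff_pow_char_mul_eq_zero p _ _ hNt fun k hk => ?_
  rcases eq_or_ne k t with rfl | hkt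
  · exact ZMod.coeff_one_sub_two_mul_X_pow_mul_one_sub_X_pow (by omega) hmodd (by omega) (by omega)
  · have hkp : t + p ≤ k := by
      by_contra! hlt
      exact hkt (hk.eq_of_abs_lt (abs_lt.mpr (by omega)))
    refine Polynomial.coeff_eq_zero_of_natDegree_lt (lt_of_le_of_lt ?_ (b := m + e) (by omega))
    compute_degree

/-- If `p ∈ 𝒫_n` and `p ∣ j` with `-4n + 1 ≤ j ≤ 3n`, then for all `n₁, n₂ ≥ 0`,
`p` divides `binom(2n, n₁) · binom(2n, n₂) · Z(n, n₁+n₂, j)`. -/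
theorem prime_divides_T_hat (n : ℕ) (hn : 1 ≤ n) (p : ℕ) (hp : inP n p) (j : ℤ)
    (hj1 : -(4 * (n : ℤ)) + 1 ≤ j) (hj2 : j ≤ 3 * n) (hpj : (p : ℤ) ∣ j)
    (n₁ n₂ : ℕ) :
    (p : ℤ) ∣ ((2 * n).choose n₁ : ℤ) * ((2 * n).choose n₂ : ℤ) * Z n (n₁ + n₂) j := by
  by_cases h₁ : n₁ % p ≤ 2 * n % p
  · by_cases h₂ : n₂ % p ≤ 2 * n % p
    · exact (dvd_Z_of_mod_le_mod hp hj2 hpj h₁ h₂).mul_left _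
    · exact ((Int.natCast_dvd_natCast.mpr
        (hp.1.dvd_choose_of_mod_lt_mod (not_le.mp h₂))).mul_left _).mul_right _
  · exact ((Int.natCast_dvd_natCast.mpr
      (hp.1.dvd_choose_of_mod_lt_mod (not_le.mp h₁))).mul_right _).mul_right _
end

section
/- For every integer n ≥ 1 and every integer j ≤ 3n, one has the identity A_j(n) = Σ_{n₁=0}^{2n} Σ_{n₂=0}^{2n} (3−4i)^{2n−n₁}·(3+4i)^{2n−n₂}·5^{2n+2n₁+2n₂+1}·10^{−(6n−j)−1}·binom(2n,n₁)·binom(2n,n₂)·Z(n, n₁+n₂, j), the sum being a complex number that equals the rational number A_j(n). -/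
/-- The Taylor coefficients of `x ^ p` at `a`. -/
lemma iteratedDeriv_pow_div_factorial (p k : ℕ) (a : ℂ) :
    iteratedDeriv k (fun x : ℂ => x ^ p) a / (k.factorial : ℂ) = p.choose k * a ^ (p - k) := by
  have hk : (k.factorial : ℂ) ≠ 0 := by exact_mod_cast k.factorial_ne_zero
  rw [iteratedDeriv_pow, Nat.descFactorial_eq_factorial_mul_choose]
  push_cast
  field_simp

/-- The Taylor coefficients of `1 / (c - x) ^ (N + 1)` at `a`. -/
lemma iteratedDeriv_inv_const_sub_pow_div_factorial (N k : ℕ) (a c : ℂ) :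
    iteratedDeriv k (fun x : ℂ => ((c - x) ^ (N + 1))⁻¹) a / (k.factorial : ℂ) =
      (N + k).choose N * ((c - a) ^ (N + 1 + k))⁻¹ := by
  have hk : (k.factorial : ℂ) ≠ 0 := by exact_mod_cast k.factorial_ne_zero
  have hz : (fun x : ℂ => ((c - x) ^ (N + 1))⁻¹) =
      fun x => (fun y : ℂ => y ^ (-(N + 1 : ℕ) : ℤ)) (c - x) := by
    funext x
    simp only [zpow_neg, zpow_natCast]
  have hprod : ∏ i ∈ Finset.range k, ((-(N + 1 : ℕ) : ℤ) - i : ℂ) =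
      (-1) ^ k * ((N + 1).ascFactorial k : ℂ) := by
    rw [Nat.ascFactorial_eq_prod_range, Nat.cast_prod, ← Finset.card_range k,
      ← Finset.prod_const, Finset.card_range, ← Finset.prod_mul_distrib]
    refine Finset.prod_congr rfl fun i _ => ?_
    push_cast
    ring
  have hexp : (-(N + 1 : ℕ) : ℤ) - k = -((N + 1 + k : ℕ) : ℤ) := by push_cast; ring
  rw [hz, iteratedDeriv_comp_const_sub (f := fun y : ℂ => y ^ (-(N + 1 : ℕ) : ℤ)), iteratedDeriv_eq_iterate, iter_deriv_zpow', hprod, hexp]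
  simp only [zpow_neg, zpow_natCast]
  rw [Nat.ascFactorial_eq_factorial_mul_choose, Nat.choose_symm_add,
    smul_eq_mul]
  have hsq : ((-1 : ℂ) ^ k) * (-1) ^ k = 1 := by rw [← mul_pow]; simp
  push_cast
  rw [div_eq_iff hk]
  linear_combination
    ((k.factorial : ℂ) * ((N + k).choose k : ℂ) * ((c - a) ^ (N + 1 + k))⁻¹) * hsq

/-- Leibniz' rule for Taylor coefficients. -/
lemma iteratedDeriv_mul_div_factorial {f g : ℂ → ℂ} {a : ℂ} {k : ℕ}
    (hf : ContDiffAt ℂ k f a) (hg : ContDiffAt ℂ k g a) :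
    iteratedDeriv k (fun x => f x * g x) a / (k.factorial : ℂ) =
      ∑ i ∈ Finset.range (k + 1), iteratedDeriv i f a / (i.factorial : ℂ) *
        (iteratedDeriv (k - i) g a / ((k - i).factorial : ℂ)) := by
  rw [iteratedDeriv_fun_mul hf hg, Finset.sum_div]
  refine Finset.sum_congr rfl fun i hi => ?_
  have hik : i ≤ k := by simpa [Nat.lt_succ_iff] using hi
  have h := Nat.choose_mul_factorial_mul_factorial hik
  have h' : (k.choose i : ℂ) * i.factorial * (k - i).factorial = k.factorial := by
    exact_mod_cast h
  have h1 : (i.factorial : ℂ) ≠ 0 := by exact_mod_cast i.factorial_ne_zero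
  have h2 : ((k - i).factorial : ℂ) ≠ 0 := by exact_mod_cast (k - i).factorial_ne_zero
  have h3 : (k.choose i : ℂ) ≠ 0 := by exact_mod_cast (Nat.choose_pos hik).ne'
  rw [← h']
  field_simp

lemma zchoose_add_sub_eq_choose {N k i : ℕ} (h : i ≤ k) :
    zchoose ((N : ℤ) + k - i) N = (N + (k - i)).choose N := by
  have e : (N : ℤ) + k - i = (N + (k - i) : ℕ) := by omega
  rw [e, zchoose, if_pos (by omega)]
  simp only [Int.toNat_natCast]

lemma zchoose_eq_zero_of_lt {a b : ℤ} (h : a < b) : zchoose a b = 0 := by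
  unfold zchoose
  split_ifs with h'
  · exact_mod_cast Nat.choose_eq_zero_of_lt (by omega)
  · rfl

/-- The Taylor coefficients of `x ^ (2M) / (5 - x) ^ (N + 1)` at `-5`. -/
lemma iteratedDeriv_pow_mul_inv_div_factorial (M N k : ℕ) :
    iteratedDeriv k (fun x : ℂ => x ^ (2 * M) * ((5 - x) ^ (N + 1))⁻¹) (-5) /
        (k.factorial : ℂ) =
      5 ^ (2 * M) * ((10 : ℂ) ^ (N + k + 1))⁻¹ *
        ((∑ i ∈ Finset.range (2 * M + 1),
          (-2) ^ i * ((2 * M).choose i : ℤ) * zchoose ((N : ℤ) + k - i) N : ℤ) : ℂ) := by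
  have hne : ((5 : ℂ) - -5) ^ (N + 1) ≠ 0 := by norm_num
  have hinv : ContDiffAt ℂ k (fun x : ℂ => ((5 - x) ^ (N + 1))⁻¹) (-5) :=
    ContDiffAt.inv (by fun_prop) hne
  rw [iteratedDeriv_mul_div_factorial (by fun_prop) hinv]
  simp only [iteratedDeriv_pow_div_factorial, iteratedDeriv_inv_const_sub_pow_div_factorial]
  push_cast
  rw [Finset.mul_sum]
  set G : ℕ → ℂ := fun i => 5 ^ (2 * M) * ((10 : ℂ) ^ (N + k + 1))⁻¹ *
    ((-2) ^ i * ((2 * M).choose i : ℂ) * (zchoose ((N : ℤ) + k - i) N : ℂ)) with hG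
  have hsub : ∀ m, m ≤ k + (2 * M) → Finset.range (m + 1) ⊆ Finset.range (k + 2 * M + 1) :=
    fun m hm => Finset.range_subset_range.2 (by omega)
  trans ∑ i ∈ Finset.range (k + 1), G i
  · refine Finset.sum_congr rfl fun i hi => ?_
    have hik : i ≤ k := by simpa [Nat.lt_succ_iff] using hi
    rcases lt_or_ge (2 * M) i with hiM | hiM
    · simp [hG, Nat.choose_eq_zero_of_lt hiM]
    · simp only [hG, zchoose_add_sub_eq_choose hik]
      have h5 : ((-5 : ℂ)) ^ (2 * M - i) * (-5) ^ i = 5 ^ (2 * M) := by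
        rw [← pow_add, Nat.sub_add_cancel hiM, (even_two_mul M).neg_pow]
      have h10 : (10 : ℂ) ^ (N + 1 + (k - i)) * 10 ^ i = 10 ^ (N + k + 1) := by
        rw [← pow_add]; congr 1; omega
      have h2 : (-2 : ℂ) ^ i * (-5) ^ i = 10 ^ i := by rw [← mul_pow]; norm_num
      rw [← h5, ← h10, ← h2, show (5 : ℂ) - -5 = 10 by norm_num]
      push_cast
      field_simp
  · rw [Finset.sum_subset (hsub k (by omega)), ← Finset.sum_subset (hsub (2 * M) (by omega))]
    · intro i _ hi
      have hi' : 2 * M < i := by simpa [Nat.lt_succ_iff] using hi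
      simp [hG, Nat.choose_eq_zero_of_lt hi']
    · intro i _ hi
      have hi' : k < i := by simpa [Nat.lt_succ_iff] using hi
      simp [hG, zchoose_eq_zero_of_lt (show (N : ℤ) + k - i < N by omega)]

lemma quartic_pow_eq_sum (r : ℕ) (x : ℂ) :
    (x ^ 4 + 6 * x ^ 2 + 25) ^ r =
      ∑ n₁ ∈ Finset.range (r + 1), ∑ n₂ ∈ Finset.range (r + 1),
        (3 - 4 * Complex.I) ^ (r - n₁) * (3 + 4 * Complex.I) ^ (r - n₂) *
          (r.choose n₁ : ℂ) * (r.choose n₂ : ℂ) * x ^ (2 * (n₁ + n₂)) := by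
  have h : x ^ 4 + 6 * x ^ 2 + 25 =
      (x ^ 2 + (3 - 4 * Complex.I)) * (x ^ 2 + (3 + 4 * Complex.I)) := by
    linear_combination (16 : ℂ) * Complex.I_sq
  rw [h, mul_pow, add_pow, add_pow, Finset.sum_mul_sum]
  refine Finset.sum_congr rfl fun n₁ _ => Finset.sum_congr rfl fun n₂ _ => ?_
  ring

/-- The identity
`A_j(n) = Σ_{n₁=0}^{2n} Σ_{n₂=0}^{2n} (3-4i)^{2n-n₁} (3+4i)^{2n-n₂} 5^{2n+2n₁+2n₂+1}
· 10^{-(6n-j)-1} · binom(2n,n₁) binom(2n,n₂) Z(n, n₁+n₂, j)`. -/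
theorem A_eq_double_sum (n : ℕ) (hn : 1 ≤ n) (j : ℤ) (hj : j ≤ 3 * n) :
    A n j =
      ∑ n₁ ∈ Finset.range (2 * n + 1), ∑ n₂ ∈ Finset.range (2 * n + 1),
        (3 - 4 * Complex.I) ^ (2 * n - n₁) * (3 + 4 * Complex.I) ^ (2 * n - n₂) *
          (5 : ℂ) ^ (2 * n + 2 * n₁ + 2 * n₂ + 1) *
          (10 : ℂ) ^ (-(6 * (n : ℤ) - j) - 1) *
          ((2 * n).choose n₁ : ℂ) * ((2 * n).choose n₂ : ℂ) * (Z n (n₁ + n₂) j : ℂ) := by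
  obtain ⟨k, hk⟩ : ∃ k : ℕ, 3 * (n : ℤ) - j = k := ⟨_, (Int.toNat_of_nonneg (by omega)).symm⟩
  have hf : (fun x : ℂ =>
        5 * x ^ (2 * n) * (x ^ 4 + 6 * x ^ 2 + 25) ^ (2 * n) / (5 - x) ^ (3 * n + 1)) =
      fun x => ∑ n₁ ∈ Finset.range (2 * n + 1), ∑ n₂ ∈ Finset.range (2 * n + 1),
        (5 * ((3 - 4 * Complex.I) ^ (2 * n - n₁) * (3 + 4 * Complex.I) ^ (2 * n - n₂) *
          ((2 * n).choose n₁ : ℂ) * ((2 * n).choose n₂ : ℂ))) *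
          (x ^ (2 * (n + (n₁ + n₂))) * ((5 - x) ^ (3 * n + 1))⁻¹) := by
    funext x
    rw [quartic_pow_eq_sum, div_eq_mul_inv, Finset.mul_sum, Finset.sum_mul]
    refine Finset.sum_congr rfl fun n₁ _ => ?_
    rw [Finset.mul_sum, Finset.sum_mul]
    refine Finset.sum_congr rfl fun n₂ _ => ?_
    rw [mul_add 2 n, pow_add]
    ring
  have hne : ((5 : ℂ) - -5) ^ (3 * n + 1) ≠ 0 := by norm_num
  have hinv : ContDiffAt ℂ k (fun x : ℂ => ((5 - x) ^ (3 * n + 1))⁻¹) (-5) :=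
    ContDiffAt.inv (by fun_prop) hne
  rw [A, hk, Int.toNat_natCast, hf, iteratedDeriv_fun_sum (fun _ _ => by fun_prop), Finset.mul_sum]
  refine Finset.sum_congr rfl fun n₁ _ => ?_
  rw [iteratedDeriv_fun_sum (fun _ _ => by fun_prop), Finset.mul_sum]
  refine Finset.sum_congr rfl fun n₂ _ => ?_
  have hZ : Z n (n₁ + n₂) j = ∑ i ∈ Finset.range (2 * (n + (n₁ + n₂)) + 1),
      (-2) ^ i * ((2 * (n + (n₁ + n₂))).choose i : ℤ) *
        zchoose (((3 * n : ℕ) : ℤ) + k - i) (3 * n : ℕ) := by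
    rw [Z, ← mul_add 2 n, ← hk]
    refine Finset.sum_congr rfl fun i _ => ?_
    congr 2
    push_cast
    ring
  have hexp : -(6 * (n : ℤ) - j) - 1 = -((3 * n + k + 1 : ℕ) : ℤ) := by push_cast; omega
  have h := iteratedDeriv_pow_mul_inv_div_factorial (n + (n₁ + n₂)) (3 * n) k
  rw [← hZ] at h
  rw [iteratedDeriv_const_mul_field, hexp, zpow_neg, zpow_natCast, one_div_mul_eq_div,
    mul_div_assoc, h]
  ring
end

section
/- Let n ≥ 1 and m ≥ 0 be integers and let j be an integer with j ≤ 3n and 4n − 2m − j ≥ 0. Then Z(n,m,j) = (−1)^{n+m} · Σ_{k ∈ ℤ} (−1)^k·binom(2n+2m, n+m+k)·binom(4n−2m−j, 2n−m−k), where the sum over k has only finitely many nonzero terms. -/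
open Polynomial in
theorem sum_neg_two_pow_mul_choose_mul_choose (N M P : ℕ) :
    ∑ i ∈ Finset.range (N + 1), (-2 : ℤ) ^ i * N.choose i * ((N + M - i).choose P : ℤ) =
      ((X - 1 : ℤ[X]) ^ N * (1 + X) ^ M).coeff P := by
  have h : (X - 1 : ℤ[X]) ^ N * (1 + X) ^ M =
      ∑ i ∈ Finset.range (N + 1), C ((-2 : ℤ) ^ i * N.choose i) * (1 + X) ^ (N + M - i) := by
    have h2 : (X - 1 : ℤ[X]) = C (-2) + (1 + X) := by
      simp only [map_neg, map_ofNat]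
      ring
    rw [h2, add_pow, Finset.sum_mul]
    refine Finset.sum_congr rfl fun i hi => ?_
    have hiN : i ≤ N := Nat.lt_succ_iff.mp (Finset.mem_range.mp hi)
    rw [Nat.sub_add_comm hiN, pow_add, C_mul, C_pow, C_eq_natCast]
    ring
  rw [h, finsetSum_coeff]
  exact Finset.sum_congr rfl fun i _ => by rw [coeff_C_mul, coeff_one_add_X_pow]

open Polynomial in
theorem sum_neg_one_pow_mul_choose_mul_zchoose (N M P : ℕ) :
    ∑ i ∈ Finset.range (N + 1), (-1 : ℤ) ^ i * N.choose i * zchoose M ((P : ℤ) - i) =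
      ((1 - X : ℤ[X]) ^ N * (1 + X) ^ M).coeff P := by
  have h : (1 - X : ℤ[X]) ^ N * (1 + X) ^ M =
      ∑ i ∈ Finset.range (N + 1), C ((-1 : ℤ) ^ i * N.choose i) * (X ^ i * (1 + X) ^ M) := by
    have h2 : (1 - X : ℤ[X]) = C (-1) * X + 1 := by
      simp only [map_neg, map_one]
      ring
    rw [h2, add_pow, Finset.sum_mul]
    refine Finset.sum_congr rfl fun i _ => ?_
    rw [mul_pow, one_pow, C_mul, C_pow, C_eq_natCast]
    ring
  rw [h, finsetSum_coeff]
  refine Finset.sum_congr rfl fun i _ => ?_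
  rw [coeff_C_mul, coeff_X_pow_mul']
  split_ifs with hi
  · rw [coeff_one_add_X_pow, zchoose, if_pos (by omega), ← Nat.cast_sub hi, Int.toNat_natCast,
      Int.toNat_natCast]
  · rw [zchoose, if_neg (by omega)]

/-- Transformation of the binomial sum:
`Z(n,m,j) = (-1)^{n+m} Σ_{k ∈ ℤ} (-1)^k binom(2n+2m, n+m+k) binom(4n-2m-j, 2n-m-k)`.
Only the terms with `-(n+m) ≤ k ≤ n+m` are nonzero (the first binomial factor vanishes
otherwise), which makes the sum over `k ∈ ℤ` finite. -/
theorem Z_transformed (n : ℕ) (hn : 1 ≤ n) (m : ℕ) (j : ℤ) (hj : j ≤ 3 * n)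
    (hj2 : 0 ≤ 4 * (n : ℤ) - 2 * m - j) :
    (∀ k : ℤ, k ∉ Finset.Icc (-((n : ℤ) + m)) ((n : ℤ) + m) →
        (k.negOnePow : ℤ) * zchoose (2 * (n : ℤ) + 2 * m) ((n : ℤ) + m + k) *
          zchoose (4 * (n : ℤ) - 2 * m - j) (2 * (n : ℤ) - m - k) = 0) ∧
      Z n m j = (-1) ^ (n + m) *
        ∑ k ∈ Finset.Icc (-((n : ℤ) + m)) ((n : ℤ) + m),
          (k.negOnePow : ℤ) * zchoose (2 * (n : ℤ) + 2 * m) ((n : ℤ) + m + k) *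
            zchoose (4 * (n : ℤ) - 2 * m - j) (2 * (n : ℤ) - m - k) := by
  refine ⟨fun k hk => ?_, ?_⟩
  · have h : zchoose (2 * (n : ℤ) + 2 * m) ((n : ℤ) + m + k) = 0 := by
      rw [Finset.mem_Icc] at hk
      unfold zchoose
      split_ifs with h
      · exact_mod_cast Nat.choose_eq_zero_of_lt (by omega)
      · rfl
    rw [h, mul_zero, zero_mul]
  obtain ⟨M, hM⟩ := Int.eq_ofNat_of_zero_le hj2
  have hL : Z n m j = ∑ i ∈ Finset.range (2 * n + 2 * m + 1),
      (-2 : ℤ) ^ i * (2 * n + 2 * m).choose i *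
        ((2 * n + 2 * m + M - i).choose (3 * n) : ℤ) := by
    refine Finset.sum_congr rfl fun i hi => ?_
    rw [Finset.mem_range] at hi
    rw [zchoose, if_pos (by omega),
      show (6 * (n : ℤ) - j - i).toNat = 2 * n + 2 * m + M - i by omega,
      show (3 * (n : ℤ)).toNat = 3 * n by omega]
  have hR : (-1 : ℤ) ^ (n + m) * ∑ k ∈ Finset.Icc (-((n : ℤ) + m)) ((n : ℤ) + m),
        (k.negOnePow : ℤ) * zchoose (2 * (n : ℤ) + 2 * m) ((n : ℤ) + m + k) *
          zchoose (4 * (n : ℤ) - 2 * m - j) (2 * (n : ℤ) - m - k) =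
      ∑ i ∈ Finset.range (2 * n + 2 * m + 1),
        (-1 : ℤ) ^ i * (2 * n + 2 * m).choose i * zchoose M (((3 * n : ℕ) : ℤ) - i) := by
    rw [Finset.mul_sum]
    refine Finset.sum_bij' (fun k _ => ((n : ℤ) + m + k).toNat) (fun i _ => (i : ℤ) - (n + m))
      ?_ ?_ ?_ ?_ ?_
    · intro k hk
      simp only [Finset.mem_Icc, Finset.mem_range] at hk ⊢
      omega
    · intro i hi
      simp only [Finset.mem_Icc, Finset.mem_range] at hi ⊢
      omega
    · intro k hk
      simp only [Finset.mem_Icc] at hk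
      omega
    · intro i hi
      omega
    · intro k hk
      rw [Finset.mem_Icc] at hk
      obtain ⟨i, hi⟩ := Int.eq_ofNat_of_zero_le (show 0 ≤ (n : ℤ) + m + k by omega)
      have hsign : (-1 : ℤ) ^ (n + m) * (k.negOnePow : ℤ) = (-1) ^ i := by
        have h : (((n + m : ℕ) + k : ℤ).negOnePow : ℤ) = ((i : ℤ).negOnePow : ℤ) := by
          rw [Nat.cast_add, hi]
        rw [Int.negOnePow_add, Units.val_mul] at h
        simpa only [Int.negOnePow_def, zpow_natCast, Units.val_pow_eq_pow_val,
          Units.val_neg, Units.val_one] using h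
      simp only [hi, Int.toNat_natCast]
      rw [hM, show 2 * (n : ℤ) - m - k = ((3 * n : ℕ) : ℤ) - i by omega, ← hsign,
        zchoose, if_pos (by omega), Int.toNat_natCast,
        show (2 * (n : ℤ) + 2 * m).toNat = 2 * n + 2 * m by omega]
      ring
  rw [hL, hR, sum_neg_two_pow_mul_choose_mul_choose, sum_neg_one_pow_mul_choose_mul_zchoose,
    ← neg_sub Polynomial.X, Even.neg_pow ⟨n + m, by ring⟩]
end

section
/- Let N ≥ 0 be an integer and let M, j be integers satisfying N + M ≥ 0, 2M − j ≥ 0 and N + M − j ≥ 0. Then Σ_{k=−N}^{N} (−1)^k·binom(2N, N+k)·binom(2M−j, M+k) equals (−1)^N·((2N)!·(2M−j)!)/((N+M)!·(N+M−j)!) times the coefficient of t^{2N} in the polynomial (1+t)^{N+M}·(1−t)^{N+M−j}. -/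
open Polynomial in
theorem coeff_one_sub_X_pow (R : Type*) [CommRing R] (n k : ℕ) :
    ((1 - X : R[X]) ^ n).coeff k = (-1) ^ k * (n.choose k : R) := by
  have h : (1 - X : R[X]) ^ n = ((1 + X) ^ n).comp (C (-1) * X) := by simp [sub_eq_add_neg]
  rw [h, comp_C_mul_X_coeff, coeff_one_add_X_pow, mul_comm]

theorem zchoose_natCast (a b : ℕ) : zchoose a b = a.choose b := by
  simp [zchoose]

theorem zchoose_of_neg (a : ℤ) {b : ℤ} (hb : b < 0) : zchoose a b = 0 := by
  simp [zchoose, hb]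

open Nat in
/-- Both sides are the product `(i + l)! n! A! B!` divided by `i! l! (A - l)! (B - i)!`, or zero
when one of `A - l`, `B - i` is negative. -/
theorem choose_mul_zchoose_mul_factorial {A B n i l : ℕ} (h : n + (i + l) = A + B) :
    ((i + l).choose i : ℚ) * zchoose n ((A : ℤ) - l) * (A ! * B !) =
      (i + l)! * n ! * (A.choose l * B.choose i) := by
  rcases lt_or_ge A l with hl | hl
  · rw [zchoose_of_neg _ (by lia), choose_eq_zero_of_lt hl]
    simp
  obtain ⟨a, rfl⟩ := Nat.exists_eq_add_of_le hl
  rw [show ((l + a : ℕ) : ℤ) - l = (a : ℕ) by push_cast; ring, zchoose_natCast]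
  rcases lt_or_ge B i with hi | hi
  · rw [choose_eq_zero_of_lt hi, choose_eq_zero_of_lt (show n < a by lia)]
    simp
  obtain ⟨b, rfl⟩ := Nat.exists_eq_add_of_le hi
  obtain rfl : n = a + b := by lia
  norm_cast
  rw [Nat.choose_symm_add (a := i), Nat.choose_symm_add (a := a), Nat.choose_symm_add (a := l),
    Nat.choose_symm_add (a := i)]
  simp only [← add_choose_mul_factorial_mul_factorial]
  ring

/-- Gessel's generating-function identity:
`Σ_{k=-N}^{N} (-1)^k binom(2N, N+k) binom(2M-j, M+k)` equals
`(-1)^N (2N)! (2M-j)! / ((N+M)! (N+M-j)!)` times the coefficient of `t^{2N}` in the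
polynomial `(1+t)^{N+M} (1-t)^{N+M-j} ∈ ℚ[t]`. -/
theorem von_szily_generalization (N : ℕ) (M j : ℤ) (h1 : 0 ≤ (N : ℤ) + M)
    (h2 : 0 ≤ 2 * M - j) (h3 : 0 ≤ (N : ℤ) + M - j) :
    (∑ k ∈ Finset.Icc (-(N : ℤ)) (N : ℤ),
        (k.negOnePow : ℚ) * (zchoose (2 * (N : ℤ)) ((N : ℤ) + k) : ℚ) *
          (zchoose (2 * M - j) (M + k) : ℚ)) =
      (-1) ^ N *
        (((2 * N).factorial : ℚ) * ((2 * M - j).toNat.factorial : ℚ) /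
          ((((N : ℤ) + M).toNat.factorial : ℚ) * (((N : ℤ) + M - j).toNat.factorial : ℚ))) *
        (((1 + Polynomial.X) ^ ((N : ℤ) + M).toNat *
            (1 - Polynomial.X) ^ ((N : ℤ) + M - j).toNat : Polynomial ℚ).coeff (2 * N)) := by
  obtain ⟨A, hA⟩ := Int.eq_ofNat_of_zero_le h1
  obtain ⟨B, hB⟩ := Int.eq_ofNat_of_zero_le h3
  obtain ⟨n, hn⟩ := Int.eq_ofNat_of_zero_le h2
  have hsum : n + 2 * N = A + B := by lia
  rw [hB, hA, hn]
  simp only [Int.toNat_natCast]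
  have hreindex : (∑ k ∈ Finset.Icc (-(N : ℤ)) (N : ℤ),
      (k.negOnePow : ℚ) * (zchoose (2 * (N : ℤ)) ((N : ℤ) + k) : ℚ) * (zchoose n (M + k) : ℚ)) =
      ∑ p ∈ Finset.HasAntidiagonal.antidiagonal (2 * N), (-1 : ℚ) ^ N * (-1) ^ p.2 *
        (((2 * N).choose p.2 : ℚ) * zchoose n ((A : ℤ) - p.1)) := by
    symm
    refine Finset.sum_bij' (fun p _ => (p.2 : ℤ) - N)
      (fun k _ => (((N : ℤ) - k).toNat, ((N : ℤ) + k).toNat)) ?_ ?_ ?_ ?_ ?_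
    · intro p hp
      rw [Finset.HasAntidiagonal.mem_antidiagonal] at hp
      rw [Finset.mem_Icc]
      lia
    · intro k hk
      rw [Finset.mem_Icc] at hk
      rw [Finset.HasAntidiagonal.mem_antidiagonal]
      lia
    · rintro ⟨l, i⟩ hp
      rw [Finset.HasAntidiagonal.mem_antidiagonal] at hp
      ext <;> dsimp at hp ⊢ <;> lia
    · intro k hk
      rw [Finset.mem_Icc] at hk
      dsimp
      lia
    · rintro ⟨l, i⟩ hp
      rw [Finset.HasAntidiagonal.mem_antidiagonal] at hp
      dsimp at hp ⊢
      rw [show (N : ℤ) + (i - N) = (i : ℕ) by ring, show M + ((i : ℤ) - N) = A - l by lia,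
        show 2 * (N : ℤ) = (2 * N : ℕ) by push_cast; rfl, zchoose_natCast,
        Int.negOnePow_sub, Int.negOnePow_def, Int.negOnePow_def]
      push_cast [zpow_natCast]
      ring
  rw [hreindex, Polynomial.coeff_mul, Finset.mul_sum]
  refine Finset.sum_congr rfl fun ⟨l, i⟩ hp => ?_
  rw [Finset.HasAntidiagonal.mem_antidiagonal] at hp
  dsimp only at hp ⊢
  have key := choose_mul_zchoose_mul_factorial (A := A) (B := B) (n := n) (i := i) (l := l) (by lia)
  rw [add_comm i l, hp] at key
  rw [coeff_one_sub_X_pow, Polynomial.coeff_one_add_X_pow]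
  have hfac : (A.factorial : ℚ) * B.factorial ≠ 0 := by positivity
  rw [eq_div_of_mul_eq hfac key]
  ring
end

section
/- Let p be an odd prime, let N ≥ 0 and a ≥ 0 be integers, and let j be an integer with p | j and a − j ≥ 0; set r = −j/p ∈ ℤ. Then the coefficient of t^{2N} in the polynomial (1+t)^a·(1−t)^{a−j} is congruent modulo p to Σ_{k=0}^{⌊N/p⌋} (−1)^{k+N}·binom(a, N−kp)·C(r, 2k), where C(r, 2k) = r(r−1)⋯(r−2k+1)/(2k)! is the generalized binomial coefficient of the integer r. -/
namespace PowerSeries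

theorem coeff_two_mul_expand_two_mul_expand_odd {R : Type*} [CommRing R] {p : ℕ} (hp : p ≠ 0)
    (hodd : Odd p) (f g : PowerSeries R) (N : ℕ) :
    coeff (2 * N) (expand 2 two_ne_zero f * expand p hp g) =
      ∑ k ∈ Finset.range (N / p + 1), coeff (N - k * p) f * coeff (2 * k) g := by
  rw [coeff_mul]
  symm
  have hle {k : ℕ} (hk : k ∈ Finset.range (N / p + 1)) : k * p ≤ N :=
    (Nat.le_div_iff_mul_le (Nat.pos_of_ne_zero hp)).1
      (Nat.lt_succ_iff.1 (Finset.mem_range.1 hk))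
  refine Finset.sum_of_injOn (fun k ↦ (2 * (N - k * p), p * (2 * k))) ?_ ?_ ?_ ?_
  · intro k _ l _ h
    simpa [hp] using congrArg Prod.snd h
  · intro k hk
    have := hle hk
    rw [Finset.mem_coe, Finset.HasAntidiagonal.mem_antidiagonal]
    dsimp only
    rw [mul_left_comm p 2 k, mul_comm p k]
    lia
  · rintro ⟨m, n⟩ hmn hnot
    rw [Finset.HasAntidiagonal.mem_antidiagonal] at hmn
    by_cases hm : 2 ∣ m
    · by_cases hn : p ∣ n
      · exfalso
        obtain ⟨m, rfl⟩ := hm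
        obtain ⟨l, rfl⟩ := hn
        have hl : 2 ∣ l := by
          refine (Nat.coprime_two_left.2 hodd).dvd_of_dvd_mul_left (k := 2) (m := p) ?_
          dsimp only at hmn
          lia
        obtain ⟨k, rfl⟩ := hl
        dsimp only at hmn
        rw [mul_left_comm p 2 k, mul_comm p k] at hmn
        apply hnot
        refine ⟨k, ?_, ?_⟩
        · rw [Finset.mem_coe, Finset.mem_range, Nat.lt_succ_iff,
            Nat.le_div_iff_mul_le (Nat.pos_of_ne_zero hp)]
          lia
        · ext <;> dsimp only
          lia
      · rw [coeff_expand_of_not_dvd p hp g hn, mul_zero]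
    · rw [coeff_expand_of_not_dvd 2 two_ne_zero f hm, zero_mul]
  · intro k _
    simp only [coeff_expand_mul]

theorem rescale_neg_one_binomialSeries_natCast (A : Type*) [CommRing A] (d : ℕ) :
    rescale (-1 : A) (binomialSeries A (d : ℤ)) = (1 - X) ^ d := by
  rw [binomialSeries_nat, map_pow, map_add, map_one, rescale_neg_one_X, sub_eq_add_neg]

/-- In characteristic `p`, `(1 + X) ^ a * (1 - X) ^ b = (1 - X ^ 2) ^ a * (1 - X ^ p) ^ r`
whenever `b = a + p * r`, the exponent `r` being an arbitrary integer. -/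
theorem one_add_X_pow_mul_one_sub_X_pow_eq_expand {A : Type*} [CommRing A] [IsDomain A] {p : ℕ}
    [Fact p.Prime] [CharP A p] {a b : ℕ} {r : ℤ} (h : (b : ℤ) = a + p * r) :
    (1 + X) ^ a * (1 - X) ^ b =
      expand 2 two_ne_zero (rescale (-1 : A) (binomialSeries A (a : ℤ))) *
        expand p (NeZero.ne p) (rescale (-1 : A) (binomialSeries A r)) := by
  have : CharP A⟦X⟧ p := charP_of_injective_ringHom (C_injective (R := A)) p
  have hexp (d : ℕ) : expand p (NeZero.ne p) (rescale (-1 : A) (binomialSeries A (d : ℤ))) =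
      (1 - X) ^ (p * d) := by
    rw [rescale_neg_one_binomialSeries_natCast, map_pow, map_sub, map_one, expand_X, pow_mul,
      sub_pow_char 1 (X : A⟦X⟧), one_pow]
  have hr : r + ((-r).toNat : ℤ) = (r.toNat : ℤ) := by lia
  have hnat : b + p * (-r).toNat = a + p * r.toNat := by
    zify
    rw [h, add_assoc, ← mul_add, hr]
  have hne : (1 - X : A⟦X⟧) ^ (p * (-r).toNat) ≠ 0 := by
    refine pow_ne_zero _ fun h0 ↦ ?_
    simpa using congrArg constantCoeff h0
  apply mul_right_cancel₀ hne
  rw [mul_assoc, ← pow_add, hnat, mul_assoc, ← hexp (-r).toNat, ← map_mul, ← map_mul,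
    ← binomialSeries_add, hr, hexp, rescale_neg_one_binomialSeries_natCast, map_pow, map_sub,
    map_one, expand_X, pow_add, ← mul_assoc, ← mul_pow]
  ring

end PowerSeries

/-- For an odd prime `p`, integers `N, a ≥ 0`, and an integer `j` with `p ∣ j` and
`a - j ≥ 0`, setting `r = -j/p`, the coefficient of `t^{2N}` in `(1+t)^a (1-t)^{a-j}`
is congruent modulo `p` to `Σ_{k=0}^{⌊N/p⌋} (-1)^{k+N} binom(a, N-kp) C(r, 2k)`,
where `C(r, s) = r(r-1)⋯(r-s+1)/s!` is the generalized binomial coefficient. -/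
theorem coeff_congruence_mod_p (p : ℕ) (hp : p.Prime) (hodd : Odd p) (N a : ℕ) (j : ℤ)
    (hpj : (p : ℤ) ∣ j) (haj : 0 ≤ (a : ℤ) - j) :
    (((1 + Polynomial.X) ^ a * (1 - Polynomial.X) ^ ((a : ℤ) - j).toNat :
        Polynomial ℤ).coeff (2 * N)) ≡
      (∑ k ∈ Finset.range (N / p + 1),
        (-1) ^ (k + N) * (a.choose (N - k * p) : ℤ) * Ring.choose (-j / p) (2 * k))
      [ZMOD (p : ℤ)] := by
  have : Fact p.Prime := ⟨hp⟩
  obtain ⟨q, rfl⟩ := hpj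
  have hp0 : (p : ℤ) ≠ 0 := mod_cast hp.ne_zero
  have hr : -((p : ℤ) * q) / p = -q := by
    rw [← mul_neg, Int.mul_ediv_cancel_left _ hp0]
  rw [hr, ← ZMod.intCast_eq_intCast_iff]
  have hb : ((((a : ℤ) - p * q).toNat : ℕ) : ℤ) = a + p * (-q) := by
    rw [Int.toNat_of_nonneg haj]
    ring
  have key := congrArg (PowerSeries.coeff (2 * N))
    (PowerSeries.one_add_X_pow_mul_one_sub_X_pow_eq_expand (A := ZMod p) hb)
  rw [PowerSeries.coeff_two_mul_expand_two_mul_expand_odd _ hodd] at key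
  have hcoe : ((1 + PowerSeries.X) ^ a * (1 - PowerSeries.X) ^ ((a : ℤ) - p * q).toNat :
      PowerSeries (ZMod p)) = (((1 + Polynomial.X) ^ a *
        (1 - Polynomial.X) ^ ((a : ℤ) - p * q).toNat : Polynomial ℤ).map
          (Int.castRingHom (ZMod p)) : Polynomial (ZMod p)) := by
    simp [Polynomial.coe_sub]
  rw [hcoe, Polynomial.coeff_coe, Polynomial.coeff_map, eq_intCast] at key
  rw [key]
  push_cast
  refine Finset.sum_congr rfl fun k hk ↦ ?_
  have hk : k * p ≤ N :=
    (Nat.le_div_iff_mul_le hp.pos).1 (Nat.lt_succ_iff.1 (Finset.mem_range.1 hk))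
  have hsign : (-1 : ZMod p) ^ (N - k * p) = (-1) ^ (k + N) := by
    obtain ⟨m, rfl⟩ := Nat.exists_eq_add_of_le hk
    rw [Nat.add_sub_cancel_left, ← add_assoc, pow_add _ (k + k * p), ← mul_one_add k p,
      (hodd.one_add.mul_left k).neg_one_pow, one_mul]
  rw [PowerSeries.coeff_rescale, PowerSeries.coeff_rescale, PowerSeries.binomialSeries_coeff,
    PowerSeries.binomialSeries_coeff, hsign, Ring.choose_natCast, (even_two_mul k).neg_one_pow]
  simp
end

section
/- For every integer n ≥ 1: (i) Φ_n divides lcm(1,2,…,4n), so L_n is a positive integer; (ii) for every integer j with −4n+1 ≤ j ≤ 3n and j ≠ 0, the rational number L_n·10^{−j}·A_j(n)/j is an integer; (iii) Φ_n divides the integer A_0(n). -/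
open scoped Classical

/-- `Φ_n = ∏_{p ∈ 𝒫_n} p` (note `𝒫_n ⊆ {p : p ≤ 2n}`). -/
noncomputable def Phi (n : ℕ) : ℕ :=
  ∏ p ∈ (Finset.range (2 * n + 1)).filter (fun p => inP n p), p

/-- `lcm(1, 2, …, m)`. -/
def lcmUpTo (m : ℕ) : ℕ := (Finset.Icc 1 m).lcm id

/-- `L_n = lcm(1,2,…,4n) / Φ_n`. -/
noncomputable def L (n : ℕ) : ℕ := lcmUpTo (4 * n) / Phi n

section TaylorSeries

/-- The formal Taylor series of `f` at `c`. -/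
noncomputable def taylorSeries (f : ℂ → ℂ) (c : ℂ) : PowerSeries ℂ :=
  PowerSeries.mk fun k => iteratedDeriv k f c / (k.factorial : ℂ)

theorem taylorSeries_add {f g : ℂ → ℂ} {c : ℂ} (hf : ContDiffAt ℂ ⊤ f c)
    (hg : ContDiffAt ℂ ⊤ g c) :
    taylorSeries (fun x => f x + g x) c = taylorSeries f c + taylorSeries g c := by
  ext k
  simp only [taylorSeries, PowerSeries.coeff_mk, map_add]
  rw [iteratedDeriv_fun_add (hf.of_le le_top) (hg.of_le le_top), add_div]

theorem taylorSeries_mul {f g : ℂ → ℂ} {c : ℂ} (hf : ContDiffAt ℂ ⊤ f c)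
    (hg : ContDiffAt ℂ ⊤ g c) :
    taylorSeries (fun x => f x * g x) c = taylorSeries f c * taylorSeries g c := by
  ext k
  simp only [taylorSeries, PowerSeries.coeff_mk, PowerSeries.coeff_mul]
  rw [iteratedDeriv_fun_mul (hf.of_le le_top) (hg.of_le le_top), Finset.sum_div,
    Finset.Nat.sum_antidiagonal_eq_sum_range_succ_mk]
  refine Finset.sum_congr rfl fun i hi => ?_
  have hik : i ≤ k := Nat.lt_succ_iff.mp (Finset.mem_range.mp hi)
  rw [Nat.cast_choose ℂ hik]
  have h1 : (k.factorial : ℂ) ≠ 0 := mod_cast k.factorial_ne_zero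
  have h2 : (i.factorial : ℂ) ≠ 0 := mod_cast i.factorial_ne_zero
  have h3 : ((k - i).factorial : ℂ) ≠ 0 := mod_cast (k - i).factorial_ne_zero
  field_simp

theorem taylorSeries_const (a c : ℂ) : taylorSeries (fun _ => a) c = PowerSeries.C a := by
  ext k
  simp only [taylorSeries, PowerSeries.coeff_mk, iteratedDeriv_const, PowerSeries.coeff_C]
  split_ifs with h <;> simp [h]

theorem taylorSeries_id (c : ℂ) :
    taylorSeries (fun x => x) c = PowerSeries.X + PowerSeries.C c := by
  ext k
  simp only [taylorSeries, PowerSeries.coeff_mk, iteratedDeriv_fun_id, PowerSeries.coeff_C,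
    map_add, PowerSeries.coeff_X]
  rcases k with _ | _ | k <;> simp

theorem contDiffAt_eval (q : Polynomial ℂ) (c : ℂ) : ContDiffAt ℂ ⊤ (fun x => q.eval x) c := by
  simpa using (q.contDiff_aeval (𝕜 := ℂ) ⊤).contDiffAt (x := c)

theorem taylorSeries_eval (q : Polynomial ℂ) (c : ℂ) :
    taylorSeries (fun x => q.eval x) c =
      Polynomial.aeval (PowerSeries.X + PowerSeries.C c) q := by
  have smooth (q : Polynomial ℂ) : ContDiffAt ℂ ⊤ (fun x => q.eval x) c :=
    contDiffAt_eval q c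
  induction q using Polynomial.induction_on with
  | C a => simpa using taylorSeries_const a c
  | add p q hp hq =>
    simp only [Polynomial.eval_add, map_add]
    rw [taylorSeries_add (smooth p) (smooth q), hp, hq]
  | monomial n a h =>
    have : (fun x : ℂ => (Polynomial.C a * Polynomial.X ^ (n + 1)).eval x) =
        fun x => (Polynomial.C a * Polynomial.X ^ n).eval x * x := by
      ext x
      simp only [Polynomial.eval_mul, Polynomial.eval_C, Polynomial.eval_pow, Polynomial.eval_X]
      ring
    rw [this, taylorSeries_mul (smooth _) (g := fun x => x) contDiffAt_id, h, taylorSeries_id,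
      pow_succ, ← mul_assoc, map_mul _ (Polynomial.C a * _), Polynomial.aeval_X]

theorem taylorSeries_div_mul {q r : Polynomial ℂ} {c : ℂ} (hr : r.eval c ≠ 0) :
    taylorSeries (fun x => q.eval x / r.eval x) c *
        Polynomial.aeval (PowerSeries.X + PowerSeries.C c) r =
      Polynomial.aeval (PowerSeries.X + PowerSeries.C c) q := by
  have hr' : ContDiffAt ℂ ⊤ (fun x => r.eval x) c := contDiffAt_eval r c
  rw [← taylorSeries_eval, ← taylorSeries_eval,
    ← taylorSeries_mul (f := fun x => q.eval x / r.eval x) ((contDiffAt_eval q c).div hr' hr) hr']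
  ext k
  simp only [taylorSeries, PowerSeries.coeff_mk]
  congr 1
  apply Filter.EventuallyEq.iteratedDeriv_eq
  filter_upwards [r.continuous.continuousAt.eventually_ne hr] with x hx
  exact div_mul_cancel₀ _ hx

end TaylorSeries

section Laurent

/-- After the substitution `x = -5 + 10 s`, the numerator of `R_n` is a constant multiple of the
`2n`-th power of this polynomial in `s`. -/
noncomputable def scaledBase : Polynomial ℤ :=
  (1 - 2 * Polynomial.X) * (5 * Polynomial.X ^ 2 - 4 * Polynomial.X + 1) *
    (5 * Polynomial.X ^ 2 - 6 * Polynomial.X + 2)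

/-- The expansion in `s` of `scaledBase ^ (2n) / (1 - s) ^ (3n + 1)`. -/
noncomputable def scaledSeries (n : ℕ) : PowerSeries ℤ :=
  (scaledBase : PowerSeries ℤ) ^ (2 * n) * (PowerSeries.mk 1) ^ (3 * n + 1)

theorem scaledSeries_mul (n : ℕ) :
    scaledSeries n * (1 - PowerSeries.X) ^ (3 * n + 1) =
      (scaledBase : PowerSeries ℤ) ^ (2 * n) := by
  rw [scaledSeries, mul_assoc, ← mul_pow, PowerSeries.mk_one_mul_one_sub_eq_one, one_pow, mul_one]

theorem rescale_taylorSeries (n : ℕ) :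
    PowerSeries.rescale 10 (taylorSeries (fun x : ℂ =>
        5 * x ^ (2 * n) * (x ^ 4 + 6 * x ^ 2 + 25) ^ (2 * n) / (5 - x) ^ (3 * n + 1)) (-5)) =
      PowerSeries.C (10 ^ (3 * n) * 4 ^ n / 2) *
        PowerSeries.map (Int.castRingHom ℂ) (scaledSeries n) := by
  have key := taylorSeries_div_mul (c := -5)
    (q := 5 * Polynomial.X ^ (2 * n) *
      (Polynomial.X ^ 4 + 6 * Polynomial.X ^ 2 + 25) ^ (2 * n))
    (r := (5 - Polynomial.X) ^ (3 * n + 1)) (by norm_num)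
  simp only [Polynomial.eval_mul, Polynomial.eval_pow, Polynomial.eval_add, Polynomial.eval_sub,
    Polynomial.eval_X, Polynomial.eval_ofNat, map_mul, map_pow, map_add, map_sub,
    Polynomial.aeval_X, map_ofNat, map_neg] at key
  have key' := congrArg (PowerSeries.rescale (10 : ℂ)) key
  simp only [map_mul, map_pow, map_add, map_sub, map_neg, map_ofNat, PowerSeries.rescale_X] at key'
  have coe_ofNat (k : ℕ) [k.AtLeastTwo] :
      ((ofNat(k) : Polynomial ℤ) : PowerSeries ℤ) = ofNat(k) :=
    map_ofNat Polynomial.coeToPowerSeries.ringHom k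
  have hg := congrArg (PowerSeries.map (Int.castRingHom ℂ)) (scaledSeries_mul n)
  simp only [scaledBase, Polynomial.coe_mul, Polynomial.coe_add, Polynomial.coe_sub,
    Polynomial.coe_one, Polynomial.coe_pow, Polynomial.coe_X, coe_ofNat, map_mul, map_pow, map_add,
    map_sub, map_one, map_ofNat, PowerSeries.map_X] at hg
  have hC : PowerSeries.C ((10 : ℂ) ^ (3 * n) * 4 ^ n / 2) * 10 = 5 * 10 ^ (3 * n) * 4 ^ n := by
    have : ((10 : ℂ) ^ (3 * n) * 4 ^ n / 2) * 10 = 5 * 10 ^ (3 * n) * 4 ^ n := by ring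
    simpa only [map_mul, map_pow, map_ofNat] using congrArg (PowerSeries.C (R := ℂ)) this
  have hden : (10 * (1 - PowerSeries.X) : PowerSeries ℂ) ≠ 0 := by
    intro h
    have h0 := congrArg PowerSeries.constantCoeff h
    rw [map_mul, map_ofNat, map_sub, map_one, PowerSeries.constantCoeff_X, map_zero] at h0
    norm_num at h0
  apply mul_right_cancel₀ (pow_ne_zero (3 * n + 1) hden)
  rw [show (10 * (1 - PowerSeries.X) : PowerSeries ℂ) = 5 - (10 * PowerSeries.X + -5) by ring, key',
    show (5 - (10 * PowerSeries.X + -5) : PowerSeries ℂ) = 10 * (1 - PowerSeries.X) by ring, mul_pow,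
    mul_mul_mul_comm, hg, pow_succ (10 : PowerSeries ℂ), ← mul_assoc, mul_right_comm _ _ 10, hC,
    mul_assoc 5, ← mul_pow]
  set X : PowerSeries ℂ := PowerSeries.X
  rw [show (10 * X + -5) * ((10 * X + -5) ^ 4 + 6 * (10 * X + -5) ^ 2 + 25) =
    (-2000) * ((1 - 2 * X) * (5 * X ^ 2 - 4 * X + 1) * (5 * X ^ 2 - 6 * X + 2)) by ring, mul_pow]
  have hnum : (-2000 : PowerSeries ℂ) ^ (2 * n) = 10 ^ (3 * n) * 4 ^ n * 10 ^ (3 * n) := by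
    simp only [pow_mul, ← mul_pow]
    norm_num
  rw [hnum]
  ring

end Laurent

section Congruence

theorem coeff_pred_eq_zero_of_antisymm {p : ℕ} [Fact p.Prime] (hp : p ≠ 2)
    {P : Polynomial (ZMod p)} (hdeg : P.natDegree < 2 * p - 2)
    (hP : ∀ x, P.eval (1 - x) = -P.eval x) : P.coeff (p - 1) = 0 := by
  have hp2 : 2 < p := lt_of_le_of_ne (Fact.out : p.Prime).two_le hp.symm
  have hsum : ∑ x, P.eval x = 0 := by
    have h : ∑ x, P.eval x = -∑ x, P.eval x := by
      rw [← Finset.sum_neg_distrib, ← Equiv.sum_comp (Equiv.subLeft (1 : ZMod p))]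
      exact Finset.sum_congr rfl fun x _ => hP x
    have : (2 : ZMod p) ≠ 0 := by
      intro h0
      have : p ∣ 2 := (ZMod.natCast_eq_zero_iff 2 p).mp (by exact_mod_cast h0)
      exact absurd (Nat.le_of_dvd two_pos this) (by omega)
    have h2 : (2 : ZMod p) * ∑ x, P.eval x = 0 := by linear_combination h
    exact (mul_eq_zero.mp h2).resolve_left this
  have hpow (i : ℕ) (hi : i < 2 * p - 2) :
      ∑ x : ZMod p, x ^ i = if i = p - 1 then -1 else 0 := by
    have low (i : ℕ) (hi : i < p - 1) : ∑ x : ZMod p, x ^ i = 0 :=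
      FiniteField.sum_pow_lt_card_sub_one _ i (by simpa [ZMod.card] using hi)
    split_ifs with h
    · subst h
      have (x : ZMod p) : x ^ (p - 1) = 1 - if x = 0 then 1 else 0 := by
        split_ifs with hx
        · subst hx; simp; omega
        · simp [ZMod.pow_card_sub_one_eq_one hx]
      simp [this]
    · rcases lt_or_ge i (p - 1) with h' | h'
      · exact low i h'
      · rw [← low (i - (p - 1)) (by omega)]
        refine Finset.sum_congr rfl fun x _ => ?_
        calc x ^ i = x ^ p * x ^ (i - p) := by rw [← pow_add]; congr 1; omega
          _ = x ^ (i - (p - 1)) := by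
            rw [ZMod.pow_card, ← pow_succ']; congr 1; omega
  simp_rw [Polynomial.eval_eq_sum_range' hdeg] at hsum
  rw [Finset.sum_comm] at hsum
  simp_rw [← Finset.mul_sum] at hsum
  rw [Finset.sum_congr rfl fun i hi => by rw [hpow i (Finset.mem_range.mp hi)]] at hsum
  simpa [show p - 1 < 2 * p - 2 by omega] using hsum

theorem coeff_pow_char_eq_zero {p : ℕ} [Fact p.Prime] (f : PowerSeries (ZMod p)) {k : ℕ}
    (hk : ¬ p ∣ k) : PowerSeries.coeff k (f ^ p) = 0 := by
  obtain _ | k := k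
  · simp at hk
  · have h := PowerSeries.coeff_derivative (f ^ p) k
    rw [PowerSeries.derivative_pow] at h
    have hp : (p : PowerSeries (ZMod p)) = 0 := by
      rw [← map_natCast (PowerSeries.C (R := ZMod p)), CharP.cast_eq_zero, map_zero]
    rw [hp, zero_mul, zero_mul, map_zero] at h
    refine (mul_eq_zero.mp h.symm).resolve_right fun h0 => hk ?_
    exact (ZMod.natCast_eq_zero_iff _ _).mp (by exact_mod_cast h0)

theorem coeff_mul_pow_char_eq_zero {p : ℕ} [Fact p.Prime] {P : Polynomial (ZMod p)}
    (hdeg : P.natDegree < 2 * p - 1) (hP : P.coeff (p - 1) = 0) (f : PowerSeries (ZMod p))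
    {k : ℕ} (hk : p ∣ k + 1) : PowerSeries.coeff k ((P : PowerSeries (ZMod p)) * f ^ p) = 0 := by
  rw [PowerSeries.coeff_mul]
  refine Finset.sum_eq_zero fun ⟨i, m⟩ him => ?_
  rw [Finset.HasAntidiagonal.mem_antidiagonal] at him
  simp only at him ⊢
  by_cases hm : p ∣ m
  · rw [Polynomial.coeff_coe]
    have hi : p ∣ i + 1 := by
      rw [← him, show i + m + 1 = (i + 1) + m by ring] at hk
      exact (Nat.dvd_add_left hm).mp hk
    obtain ⟨c, hc⟩ := hi
    have hp2 := (Fact.out : p.Prime).two_le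
    obtain rfl | rfl | hc2 : c = 0 ∨ c = 1 ∨ 2 ≤ c := by omega
    · omega
    · rw [show i = p - 1 by omega, hP, zero_mul]
    · have : p * 2 ≤ p * c := Nat.mul_le_mul_left p hc2
      rw [Polynomial.coeff_eq_zero_of_natDegree_lt (by omega), zero_mul]
  · rw [coeff_pow_char_eq_zero f hm, mul_zero]

theorem prime_dvd_coeff_scaledSeries {n p : ℕ} (hp : p.Prime) (hp2 : p ≠ 2)
    (h1 : p ≤ 2 * (n % p)) (h2 : 3 * (n % p) < 2 * p) {k : ℕ} (hk : (p : ℤ) ∣ 3 * n - k) :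
    (p : ℤ) ∣ PowerSeries.coeff k (scaledSeries n) := by
  have : Fact p.Prime := ⟨hp⟩
  set q := n / p
  set r := n % p
  have hn : p * q + r = n := Nat.div_add_mod n p
  obtain ⟨a, ha⟩ := Nat.exists_eq_add_of_le h1
  obtain ⟨b, hb⟩ : ∃ b, 2 * p = 3 * r + 1 + b := Nat.exists_eq_add_of_le h2
  have hodd : Odd a := by
    have := hp.eq_two_or_odd'.resolve_left hp2
    rw [Nat.odd_iff] at *
    omega
  set u : Polynomial (ZMod p) := scaledBase.map (Int.castRingHom (ZMod p)) with hu
  set V : PowerSeries (ZMod p) := PowerSeries.map (Int.castRingHom (ZMod p)) (PowerSeries.mk 1)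
  have hV : V * (1 - PowerSeries.X) = 1 := by
    simpa using congrArg (PowerSeries.map (Int.castRingHom (ZMod p)))
      (PowerSeries.mk_one_mul_one_sub_eq_one ℤ)
  set P : Polynomial (ZMod p) := u ^ a * (Polynomial.X * (1 - Polynomial.X)) ^ b with hPdef
  have hu' : u = (1 - 2 * Polynomial.X) * (5 * Polynomial.X ^ 2 - 4 * Polynomial.X + 1) *
      (5 * Polynomial.X ^ 2 - 6 * Polynomial.X + 2) := by
    simp [hu, scaledBase]
  have hudeg : u.natDegree ≤ 5 := by
    rw [hu']; compute_degree
  have hPdeg : P.natDegree < 2 * p - 2 := by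
    have : P.natDegree ≤ a * 5 + b * 2 := by
      refine Polynomial.natDegree_mul_le_of_le (Polynomial.natDegree_pow_le_of_le a hudeg)
        (Polynomial.natDegree_pow_le_of_le b ?_)
      compute_degree
    omega
  have hPsymm (x : ZMod p) : P.eval (1 - x) = -P.eval x := by
    have hux : u.eval (1 - x) = -u.eval x := by
      rw [hu']
      simp
      ring
    simp only [hPdef, Polynomial.eval_mul, Polynomial.eval_pow, hux, hodd.neg_pow,
      Polynomial.eval_X, Polynomial.eval_sub, Polynomial.eval_one]
    ring
  have hPcoeff := coeff_pred_eq_zero_of_antisymm hp2 hPdeg hPsymm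
  have hfac : PowerSeries.X ^ b * PowerSeries.map (Int.castRingHom (ZMod p)) (scaledSeries n) =
      (P : PowerSeries (ZMod p)) *
        ((u : PowerSeries (ZMod p)) ^ (2 * q + 1) * V ^ (3 * q + 2)) ^ p := by
    have e1 : 2 * n = p * (2 * q + 1) + a := by rw [← hn]; linear_combination ha
    have e2 : p * (3 * q + 2) = 3 * n + 1 + b := by rw [← hn]; linear_combination hb
    have hmap : PowerSeries.map (Int.castRingHom (ZMod p)) (scaledSeries n) =
        (u : PowerSeries (ZMod p)) ^ (2 * n) * V ^ (3 * n + 1) := by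
      rw [scaledSeries, map_mul, map_pow, map_pow, hu, Polynomial.polynomial_map_coe]
    have hVb : V ^ b * (1 - PowerSeries.X) ^ b = 1 := by rw [← mul_pow, hV, one_pow]
    rw [hmap, hPdef, mul_pow (_ ^ _) (_ ^ _) p, ← pow_mul, ← pow_mul, mul_comm _ p, mul_comm _ p,
      e2, e1]
    push_cast
    rw [mul_pow]
    linear_combination (-(u : PowerSeries (ZMod p)) ^ (p * (2 * q + 1) + a) * V ^ (3 * n + 1) *
      PowerSeries.X ^ b) * hVb
  rw [← ZMod.intCast_zmod_eq_zero_iff_dvd]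
  have := coeff_mul_pow_char_eq_zero (by omega) hPcoeff
    ((u : PowerSeries (ZMod p)) ^ (2 * q + 1) * V ^ (3 * q + 2)) (k := k + b) (by
      have e2 : (p : ℤ) * (3 * q + 2) = 3 * n + 1 + b := by
        rw [← hn]; push_cast; zify at hb; linear_combination hb
      obtain ⟨z, hz⟩ := hk
      zify
      exact ⟨3 * q + 2 - z, by linear_combination -e2 - hz⟩)
  rwa [← hfac, PowerSeries.coeff_X_pow_mul, PowerSeries.coeff_map, eq_intCast] at this

end Congruence

theorem ten_zpow_mul_A {n : ℕ} (hn : 1 ≤ n) {j : ℤ} (hj : j ≤ 3 * n) :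
    (10 : ℂ) ^ (-j) * A n j =
      ((2 * 4 ^ (n - 1) *
        PowerSeries.coeff (3 * (n : ℤ) - j).toNat (scaledSeries n) : ℤ) : ℂ) := by
  obtain ⟨k, hk⟩ : ∃ k : ℕ, 3 * (n : ℤ) - j = k := ⟨_, (Int.toNat_of_nonneg (by omega)).symm⟩
  obtain ⟨m, rfl⟩ : ∃ m, n = m + 1 := ⟨n - 1, by omega⟩
  have h := congrArg (PowerSeries.coeff k) (rescale_taylorSeries (m + 1))
  rw [PowerSeries.coeff_rescale, PowerSeries.coeff_C_mul, PowerSeries.coeff_map, taylorSeries,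
    PowerSeries.coeff_mk, eq_intCast] at h
  have h10 : (10 : ℂ) ^ (-j) = 10 ^ k / 10 ^ (3 * (m + 1)) := by
    rw [← zpow_natCast, ← zpow_natCast, ← zpow_sub₀ (by norm_num)]
    congr 1
    push_cast at hk ⊢
    omega
  rw [A, hk, Int.toNat_natCast, h10, one_div_mul_eq_div, div_mul_eq_mul_div, h]
  rw [Nat.add_sub_cancel]
  push_cast
  field_simp
  ring

theorem mod_bounds_of_inP {n p : ℕ} (h : inP n p) :
    p.Prime ∧ p ≠ 2 ∧ p ≤ 2 * (n % p) ∧ 3 * (n % p) < 2 * p := by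
  obtain ⟨hp, h5, h1, h2⟩ := h
  have hpos : (0 : ℝ) < p := mod_cast hp.pos
  rw [Int.fract_div_natCast_eq_div_natCast_mod] at h1 h2
  rw [div_le_div_iff₀ (by norm_num) hpos] at h1
  rw [div_lt_div_iff₀ hpos (by norm_num)] at h2
  refine ⟨hp, ?_, ?_, ?_⟩
  · rintro rfl
    have := (le_max_left _ _).trans_lt h5
    norm_num at this
  · have : p ≤ (n % p) * 2 := by exact_mod_cast (one_mul (p : ℝ) ▸ h1)
    omega
  · have : (n % p) * 3 < 2 * p := by exact_mod_cast h2
    omega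

theorem Phi_dvd {n : ℕ} {z : ℤ} (h : ∀ p, inP n p → p ≤ 2 * n → (p : ℤ) ∣ z) :
    (Phi n : ℤ) ∣ z := by
  rw [Int.natCast_dvd]
  refine Finset.prod_primes_dvd _ (fun p hp => ?_) fun p hp => ?_
  · exact (Finset.mem_filter.mp hp).2.1.prime
  · rw [Finset.mem_filter, Finset.mem_range] at hp
    exact Int.natCast_dvd.mp (h p hp.2 (by omega))

theorem dvd_lcmUpTo {m k : ℕ} (hk : 1 ≤ k) (hkm : k ≤ m) : k ∣ lcmUpTo m :=
  Finset.dvd_lcm (f := id) (Finset.mem_Icc.mpr ⟨hk, hkm⟩)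

theorem lcmUpTo_pos (m : ℕ) : 0 < lcmUpTo m := by
  refine Nat.pos_of_ne_zero fun h => ?_
  obtain ⟨k, hk, hk0⟩ := Finset.lcm_eq_zero_iff.mp h
  simp at hk hk0
  omega

/-- **Lemma 3.** (i) `Φ_n ∣ lcm(1,…,4n)`, so `L_n = lcm(1,…,4n)/Φ_n` is a positive integer;
(ii) for `-4n+1 ≤ j ≤ 3n`, `j ≠ 0`, the rational number `L_n · 10^{-j} · A_j(n)/j` is an
integer; (iii) `Φ_n` divides the integer `A_0(n)`. -/
theorem Lemma3 (n : ℕ) (hn : 1 ≤ n) :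
    Phi n ∣ lcmUpTo (4 * n) ∧ 0 < L n ∧
      (∀ j : ℤ, -(4 * (n : ℤ)) + 1 ≤ j → j ≤ 3 * n → j ≠ 0 →
        ∃ m : ℤ, (L n : ℂ) * (10 : ℂ) ^ (-j) * A n j / (j : ℂ) = (m : ℂ)) ∧
      ∃ m : ℤ, A n 0 = (Phi n : ℂ) * (m : ℂ) := by
  have hdvd : Phi n ∣ lcmUpTo (4 * n) := by
    rw [← Int.natCast_dvd_natCast]
    refine Phi_dvd fun p hp hpn => ?_
    exact_mod_cast dvd_lcmUpTo hp.1.one_le (by omega)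
  have hL : Phi n * L n = lcmUpTo (4 * n) := Nat.mul_div_cancel' hdvd
  have hLpos : 0 < Phi n * L n := hL ▸ lcmUpTo_pos _
  have hcoeff (j : ℤ) (hj : j ≤ 3 * n) (p : ℕ) (hp : inP n p) (hpj : (p : ℤ) ∣ j) :
      (p : ℤ) ∣ PowerSeries.coeff (3 * (n : ℤ) - j).toNat (scaledSeries n) := by
    obtain ⟨hp, hp2, h1, h2⟩ := mod_bounds_of_inP hp
    refine prime_dvd_coeff_scaledSeries hp hp2 h1 h2 ?_
    rwa [Int.toNat_of_nonneg (by omega), sub_sub_cancel]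
  refine ⟨hdvd, pos_of_mul_pos_right hLpos (Nat.zero_le _), fun j hj1 hj2 hj0 => ?_, ?_⟩
  · obtain ⟨e, he⟩ : j ∣ (lcmUpTo (4 * n) : ℤ) := by
      rw [Int.dvd_natCast]
      exact dvd_lcmUpTo (by omega) (by omega)
    obtain ⟨m, hm⟩ : (Phi n : ℤ) ∣
        e * PowerSeries.coeff (3 * (n : ℤ) - j).toNat (scaledSeries n) := by
      refine Phi_dvd fun p hp hpn => ?_
      by_cases hpj : (p : ℤ) ∣ j
      · exact (hcoeff j hj2 p hp hpj).mul_left _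
      · have hpl : (p : ℤ) ∣ j * e := by
          rw [← he]
          exact_mod_cast dvd_lcmUpTo hp.1.one_le (by omega)
        exact (((Nat.prime_iff_prime_int.mp hp.1).dvd_or_dvd hpl).resolve_left hpj).mul_right _
    refine ⟨2 * 4 ^ (n - 1) * m, ?_⟩
    have hj0' : (j : ℂ) ≠ 0 := mod_cast hj0
    have hΦ : (Phi n : ℂ) ≠ 0 := mod_cast (pos_of_mul_pos_left hLpos (Nat.zero_le _)).ne'
    rw [mul_assoc, ten_zpow_mul_A hn hj2, div_eq_iff hj0']
    apply mul_left_cancel₀ hΦ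
    rw [← hL] at he
    have he' : (Phi n : ℂ) * L n = j * e := mod_cast he
    have hm' : (e : ℂ) * (PowerSeries.coeff (3 * (n : ℤ) - j).toNat (scaledSeries n) : ℤ) =
        Phi n * m := mod_cast hm
    push_cast
    linear_combination
      (2 * 4 ^ (n - 1) * (PowerSeries.coeff (3 * (n : ℤ) - j).toNat (scaledSeries n) : ℤ)) * he' +
        (2 * 4 ^ (n - 1) * (j : ℂ)) * hm'
  · obtain ⟨m, hm⟩ : (Phi n : ℤ) ∣
        PowerSeries.coeff (3 * (n : ℤ) - 0).toNat (scaledSeries n) :=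
      Phi_dvd fun p hp _ => hcoeff 0 (by omega) p hp (dvd_zero _)
    refine ⟨2 * 4 ^ (n - 1) * m, ?_⟩
    have h := ten_zpow_mul_A hn (j := 0) (by omega)
    rw [neg_zero, zpow_zero, one_mul, hm] at h
    rw [h]
    push_cast
    ring
end
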